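/- Let (Ω, C, Λ) be a naive convex co-compact triple such that cdim_{F_Ω(x)}(∂_i C ∩ F_Ω(x)) ≤ 1 for all x ∈ ∂_i C. If S₁, S₂ ⊂ C are properly embedded two-dimensional simplices with F_Ω(∂S₁) ∩ F_Ω(∂S₂) ≠ ∅, where F_Ω(∂S) := ⋃_{x ∈ ∂S} F_Ω(x), then S₁ and S₂ are parallel: the vertices v₁, v₂, v₃ of S₁ and the vertices w₁, w₂, w₃ of S₂ can be labeled so that F_Ω(v_j) = F_Ω(w_j) for j = 1, 2, 3. -/

import Mathlib

open Set Filter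

noncomputable section

/-- Real projective space `P(ℝ^d)`, with the quotient topology. -/
abbrev PSpace (d : ℕ) := Projectivization ℝ (Fin d → ℝ)

instance PSpace.instTopologicalSpace (d : ℕ) : TopologicalSpace (PSpace d) :=
  inferInstanceAs (TopologicalSpace (Quotient (projectivizationSetoid ℝ (Fin d → ℝ))))

namespace Paper

variable {d : ℕ}

/-- Inhomogeneous coordinates in the affine chart determined by the linear functional `f`:
a projective point `[v]` with `f v ≠ 0` is sent to the representative `v / f v` lying in the
affine hyperplane `{f = 1}`. -/
def chartMap (f : (Fin d → ℝ) →ₗ[ℝ] ℝ) (x : PSpace d) : Fin d → ℝ :=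
  (f x.rep)⁻¹ • x.rep

/-- A subset of `P(ℝ^d)` is properly convex if there is an affine chart in which it is a
bounded convex set. -/
def IsProperlyConvex (C : Set (PSpace d)) : Prop :=
  ∃ f : (Fin d → ℝ) →ₗ[ℝ] ℝ, (∀ x ∈ closure C, f x.rep ≠ 0) ∧
    Convex ℝ (chartMap f '' C) ∧ Bornology.IsBounded (chartMap f '' C)

/-- A properly convex domain: an open, nonempty, properly convex subset of `P(ℝ^d)`. -/
def IsPCDomain (Ω : Set (PSpace d)) : Prop :=
  IsOpen Ω ∧ Ω.Nonempty ∧ IsProperlyConvex Ω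

open Classical in
/-- A choice of an affine chart containing the properly convex set `C`. -/
def chartOf (C : Set (PSpace d)) : (Fin d → ℝ) →ₗ[ℝ] ℝ :=
  if h : IsProperlyConvex C then h.choose else 0

/-- The chart map associated to the chosen chart of `C`. -/
def cmap (C : Set (PSpace d)) : PSpace d → Fin d → ℝ := chartMap (chartOf C)

/-- The Hilbert distance between `u` and `v` computed in an affine chart where the convex set
is `O`: writing the line through `u, v` as `t ↦ u + t(v-u)`, with boundary parameters
`tm = inf {t | u + t(v-u) ∈ O} ≤ 0` and `tp = sup {...} ≥ 1`, the cross-ratio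
`[a,u,v,b]` of `a = u + tm(v-u), u, v, b = u + tp(v-u)` equals `(tp(1-tm))/((-tm)(tp-1))`. -/
def hilbertDistChart (O : Set (Fin d → ℝ)) (u v : Fin d → ℝ) : ℝ :=
  if u = v then 0
  else
    (1 / 2) * Real.log
      ((sSup {t : ℝ | u + t • (v - u) ∈ O} * (1 - sInf {t : ℝ | u + t • (v - u) ∈ O})) /
        ((-(sInf {t : ℝ | u + t • (v - u) ∈ O})) * (sSup {t : ℝ | u + t • (v - u) ∈ O} - 1)))

/-- The Hilbert metric of a properly convex set `C` (open in its span). -/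
def hilbertDist (C : Set (PSpace d)) (x y : PSpace d) : ℝ :=
  hilbertDistChart (cmap C '' C) (cmap C x) (cmap C y)

/-- The closed projective line segment `[x,y]` contained in `closure C`. -/
def projSeg (C : Set (PSpace d)) (x y : PSpace d) : Set (PSpace d) :=
  {z ∈ closure C | cmap C z ∈ segment ℝ (cmap C x) (cmap C y)}

/-- The open projective line segment `(x,y)` contained in `closure C`. -/
def projOpenSeg (C : Set (PSpace d)) (x y : PSpace d) : Set (PSpace d) :=
  {z ∈ closure C | cmap C z ∈ openSegment ℝ (cmap C x) (cmap C y)}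

/-- The open face `F_C(x)` of a point `x ∈ closure C`: the set `{x}` together with all
`y ∈ closure C` such that some open line segment contained in `closure C` contains
both `x` and `y`. -/
def face (C : Set (PSpace d)) (x : PSpace d) : Set (PSpace d) :=
  insert x {y ∈ closure C | ∃ a ∈ closure C, ∃ b ∈ closure C,
    x ∈ projOpenSeg C a b ∧ y ∈ projOpenSeg C a b}

/-- The ideal boundary `∂_i C = closure C \ C`. -/
def idealBdry (C : Set (PSpace d)) : Set (PSpace d) := closure C \ C

/-- The dimension of a subset `B`, computed in the chart of the ambient convex set `C`. -/
def pdimIn (C B : Set (PSpace d)) : ℕ :=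
  Module.finrank ℝ (affineSpan ℝ (cmap C '' B)).direction

/-- The dimension of a convex subset of `P(ℝ^d)`. -/
def pdim (A : Set (PSpace d)) : ℕ := pdimIn A A

/-- The coarse dimension `cdim_C(A)` of a nonempty subset `A` of a properly convex set `C`
open in its span: the smallest `k` such that `A` is contained in an `R`-neighborhood (for the
Hilbert metric of `C`) of a `k`-dimensional convex subset `B ⊆ C`. -/
def cdim (C A : Set (PSpace d)) : ℕ :=
  sInf {k : ℕ | ∃ R : ℝ, 0 < R ∧ ∃ B : Set (PSpace d), B ⊆ C ∧
    Convex ℝ (cmap C '' B) ∧ pdimIn C B = k ∧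
    A ⊆ {p ∈ C | ∃ q ∈ B, hilbertDist C p q < R}}

/-- The cone over the standard open `(p-1)`-dimensional simplex: vectors whose first `p`
coordinates are positive and whose remaining coordinates vanish. -/
def simplexCone (p : ℕ) : Set (Fin d → ℝ) :=
  {v | (∀ i : Fin d, (i : ℕ) < p → 0 < v i) ∧ ∀ i : Fin d, p ≤ (i : ℕ) → v i = 0}

/-- `S` is the image under `g ∈ PGL_d(ℝ)` of the standard open simplex with `p` vertices. -/
def IsSimplexWithMap (p : ℕ) (S : Set (PSpace d)) (g : (Fin d → ℝ) ≃ₗ[ℝ] (Fin d → ℝ)) : Prop :=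
  S = {q : PSpace d | ∃ v ∈ simplexCone (d := d) p, ∃ hv : v ≠ 0,
        q = Projectivization.mk ℝ (g v) (by simpa using hv)}

/-- `S ⊆ P(ℝ^d)` is a simplex of dimension `k`. -/
def IsSimplexOfDim (k : ℕ) (S : Set (PSpace d)) : Prop :=
  k + 1 ≤ d ∧ ∃ g : (Fin d → ℝ) ≃ₗ[ℝ] (Fin d → ℝ), IsSimplexWithMap (k + 1) S g

/-- `S` is a simplex with vertices `v 0, …, v (p-1)` (so of dimension `p - 1`). -/
def HasVertices {p : ℕ} (S : Set (PSpace d)) (v : Fin p → PSpace d) : Prop :=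
  ∃ (hp : p ≤ d) (g : (Fin d → ℝ) ≃ₗ[ℝ] (Fin d → ℝ)),
    IsSimplexWithMap p S g ∧
    ∀ j : Fin p, v j = Projectivization.mk ℝ (g (Pi.single (Fin.castLE hp j) 1))
      (by
        simp only [ne_eq, EmbeddingLike.map_eq_zero_iff]
        intro h
        have h1 := congrFun h (Fin.castLE hp j)
        rw [Pi.single_eq_same] at h1
        exact one_ne_zero (α := ℝ) h1)

/-- `A ⊆ B` is properly embedded if the inclusion map `A ↪ B` is proper. -/
def IsProperlyEmbedded (A B : Set (PSpace d)) : Prop :=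
  ∃ h : A ⊆ B, IsProperMap (Set.inclusion h)

/-- The projective action of `GL(ℝ^d)` (hence of `PGL_d(ℝ)`) on `P(ℝ^d)`. -/
def pact (g : (Fin d → ℝ) ≃ₗ[ℝ] (Fin d → ℝ)) : PSpace d → PSpace d :=
  Projectivization.map g.toLinearMap g.injective

/-- A naive convex co-compact triple `(Ω, C, Λ)`. -/
structure NCCTriple (d : ℕ) where
  Ω : Set (PSpace d)
  C : Set (PSpace d)
  Λ : Subgroup ((Fin d → ℝ) ≃ₗ[ℝ] (Fin d → ℝ))
  isOpen_Ω : IsOpen Ω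
  nonempty_Ω : Ω.Nonempty
  properlyConvex_Ω : IsProperlyConvex Ω
  inv_Ω : ∀ g ∈ Λ, pact g '' Ω = Ω
  infinite_Λ : (Λ : Set ((Fin d → ℝ) ≃ₗ[ℝ] (Fin d → ℝ))).Infinite
  discrete_Λ : ∀ K ⊆ Ω, IsCompact K →
    {g : (Fin d → ℝ) ≃ₗ[ℝ] (Fin d → ℝ) | g ∈ Λ ∧ (pact g '' K ∩ K).Nonempty}.Finite
  C_nonempty : C.Nonempty
  C_sub : C ⊆ Ω
  C_closedInΩ : closure C ∩ Ω ⊆ C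
  C_convex : Convex ℝ (cmap Ω '' C)
  inv_C : ∀ g ∈ Λ, pact g '' C = C
  cocompact : ∃ K : Set (PSpace d), K ⊆ C ∧ IsCompact K ∧ C ⊆ ⋃ g ∈ Λ, pact g '' K

/-- The orbit of a point under a subgroup of `PGL_d(ℝ)`. -/
def porbit (Λ : Subgroup ((Fin d → ℝ) ≃ₗ[ℝ] (Fin d → ℝ))) (p : PSpace d) : Set (PSpace d) :=
  {q | ∃ g ∈ Λ, q = pact g p}

/-- The full orbital limit set `L_Ω(Λ)`. -/
def limitSet (Ω : Set (PSpace d)) (Λ : Subgroup ((Fin d → ℝ) ≃ₗ[ℝ] (Fin d → ℝ))) :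
    Set (PSpace d) :=
  ⋃ p ∈ Ω, (closure (porbit Λ p) \ porbit Λ p)

/-- The convex hull of `X ⊆ closure Ω` taken inside `Ω`. -/
def convHullIn (Ω X : Set (PSpace d)) : Set (PSpace d) :=
  {z ∈ Ω | cmap Ω z ∈ convexHull ℝ (cmap Ω '' X)}

/-- `C_Ω(Λ)`: the convex hull of the full orbital limit set in `Ω`. -/
def coreC (Ω : Set (PSpace d)) (Λ : Subgroup ((Fin d → ℝ) ≃ₗ[ℝ] (Fin d → ℝ))) :
    Set (PSpace d) :=
  convHullIn Ω (limitSet Ω Λ)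

/-- A convex co-compact group `Λ ⊆ Aut(Ω)`: an infinite discrete subgroup preserving `Ω`
such that `C_Ω(Λ)` is nonempty and `Λ` acts cocompactly on it. -/
structure CCSetup (d : ℕ) where
  Ω : Set (PSpace d)
  Λ : Subgroup ((Fin d → ℝ) ≃ₗ[ℝ] (Fin d → ℝ))
  isOpen_Ω : IsOpen Ω
  nonempty_Ω : Ω.Nonempty
  properlyConvex_Ω : IsProperlyConvex Ω
  inv_Ω : ∀ g ∈ Λ, pact g '' Ω = Ω
  infinite_Λ : (Λ : Set ((Fin d → ℝ) ≃ₗ[ℝ] (Fin d → ℝ))).Infinite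
  discrete_Λ : ∀ K ⊆ Ω, IsCompact K →
    {g : (Fin d → ℝ) ≃ₗ[ℝ] (Fin d → ℝ) | g ∈ Λ ∧ (pact g '' K ∩ K).Nonempty}.Finite
  core_nonempty : (coreC Ω Λ).Nonempty
  cocompact : ∃ K : Set (PSpace d), K ⊆ coreC Ω Λ ∧ IsCompact K ∧
    coreC Ω Λ ⊆ ⋃ g ∈ Λ, pact g '' K

/-- The Gromov product of `x, y` at `w`, with respect to the Hilbert metric of `Ω`. -/
def gromovProd (Ω : Set (PSpace d)) (w x y : PSpace d) : ℝ :=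
  (hilbertDist Ω x w + hilbertDist Ω y w - hilbertDist Ω x y) / 2

/-- `(C, d_Ω)` is Gromov hyperbolic. -/
def GromovHyperbolicOn (Ω C : Set (PSpace d)) : Prop :=
  ∃ δ : ℝ, 0 ≤ δ ∧ ∀ x ∈ C, ∀ y ∈ C, ∀ z ∈ C, ∀ w ∈ C,
    min (gromovProd Ω w x y) (gromovProd Ω w y z) - δ ≤ gromovProd Ω w x z

/-- The open Hilbert-metric ball in `Ω`. -/
def hBall (Ω : Set (PSpace d)) (x : PSpace d) (r : ℝ) : Set (PSpace d) :=
  {y ∈ Ω | hilbertDist Ω x y < r}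

/-- The Hausdorff distance between `A` and `B` (w.r.t. the Hilbert metric of `Ω`)
is less than `ε`. -/
def hausLT (Ω A B : Set (PSpace d)) (ε : ℝ) : Prop :=
  (∀ a ∈ A, ∃ b ∈ B, hilbertDist Ω a b < ε) ∧ ∀ b ∈ B, ∃ a ∈ A, hilbertDist Ω a b < ε

/-- The Hausdorff distance between `A` and `B` (w.r.t. the Hilbert metric of `Ω`)
is at most `r`. -/
def hausdorffDistLE (Ω A B : Set (PSpace d)) (r : ℝ) : Prop :=
  ∀ ε : ℝ, 0 < ε → hausLT Ω A B (r + ε)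

/-- Convergence `F n → C` in the local Hausdorff topology induced by `d_Ω`. -/
def LocalHausConv (Ω : Set (PSpace d)) (F : ℕ → Set (PSpace d)) (C : Set (PSpace d)) : Prop :=
  ∀ x ∈ Ω, ∀ r : ℝ, 0 < r → ∀ ε : ℝ, 0 < ε →
    ∀ᶠ n in atTop, hausLT Ω (F n ∩ hBall Ω x r) (C ∩ hBall Ω x r) ε

/-- A collection `𝒮` of closed subsets of `Ω` is closed and discrete in the local Hausdorff
topology: any sequence in `𝒮` converging to a nonempty closed subset of `Ω` has limit in `𝒮`
and is eventually equal to its limit. -/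
def ClosedAndDiscreteInLHT (Ω : Set (PSpace d)) (𝒮 : Set (Set (PSpace d))) : Prop :=
  ∀ F : ℕ → Set (PSpace d), (∀ n, F n ∈ 𝒮) →
    ∀ C : Set (PSpace d), C.Nonempty → C ⊆ Ω → closure C ∩ Ω ⊆ C → LocalHausConv Ω F C →
      C ∈ 𝒮 ∧ ∀ᶠ n in atTop, F n = C


namespace Core

variable {E : Type*} [NormedAddCommGroup E] [NormedSpace ℝ E]

/-- `x` lies in the closed face generated by `y`. -/
def Le (K : Set E) (x y : E) : Prop := ∃ ε : ℝ, 0 < ε ∧ y - ε • x ∈ K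

/-- same open face -/
def Eqv (K : Set E) (x y : E) : Prop := Le K x y ∧ Le K y x

structure ConeHyp (K O : Set E) (f : E →ₗ[ℝ] ℝ) (M : ℝ) : Prop where
  zero_mem : (0 : E) ∈ K
  add : ∀ x ∈ K, ∀ y ∈ K, x + y ∈ K
  smul : ∀ c : ℝ, 0 ≤ c → ∀ x ∈ K, c • x ∈ K
  closed : IsClosed K
  openO : IsOpen O
  sub : O ⊆ K
  addO : ∀ x ∈ O, ∀ y ∈ K, x + y ∈ O
  smulO : ∀ c : ℝ, 0 < c → ∀ x ∈ O, c • x ∈ O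
  bound : ∀ x ∈ K, ‖x‖ ≤ M * f x
  fpos : ∀ x ∈ K, x ≠ 0 → 0 < f x
  zeroO : (0 : E) ∉ O

variable {K O Q : Set E} {f : E →ₗ[ℝ] ℝ} {M : ℝ}

section
variable (h : ConeHyp K O f M)
include h

theorem Le.refl' {x : E} (hx : x ∈ K) : Le K x x :=
  ⟨1, one_pos, by simpa using h.zero_mem⟩

theorem Le.of_sub {x y : E} (hx : y - x ∈ K) : Le K x y := ⟨1, one_pos, by simpa using hx⟩

theorem Le.trans' {x y z : E} (h1 : Le K x y) (h2 : Le K y z) : Le K x z := by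
  obtain ⟨a, ha, h1⟩ := h1
  obtain ⟨b, hb, h2⟩ := h2
  refine ⟨b * a, by positivity, ?_⟩
  have := h.add _ h2 _ (h.smul b hb.le _ h1)
  convert this using 1
  module

theorem Le.add_right {x y z : E} (h1 : Le K x y) (hz : z ∈ K) : Le K x (y + z) := by
  obtain ⟨a, ha, h1⟩ := h1
  refine ⟨a, ha, ?_⟩
  have := h.add _ h1 _ hz
  convert this using 1
  module

theorem Le.add_left {x y z : E} (h1 : Le K x y) (hz : z ∈ K) : Le K x (z + y) := by
  rw [add_comm]; exact Le.add_right h h1 hz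

theorem Le.add_le {x y z : E} (h1 : Le K x z) (h2 : Le K y z) : Le K (x + y) z := by
  obtain ⟨a, ha, h1⟩ := h1
  obtain ⟨b, hb, h2⟩ := h2
  refine ⟨a * b / (a + b), by positivity, ?_⟩
  have := h.add _ (h.smul (b / (a + b)) (by positivity) _ h1)
    _ (h.smul (a / (a + b)) (by positivity) _ h2)
  convert this using 1
  have hab : a + b ≠ 0 := by positivity
  have e : z = (b / (a + b)) • z + (a / (a + b)) • z := by
    rw [← add_smul]
    have : b / (a + b) + a / (a + b) = 1 := by field_simp; ring
    rw [this, one_smul]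
  conv_lhs => rw [e]
  rw [smul_sub, smul_sub, smul_smul, smul_smul, smul_add]
  have e1 : b / (a + b) * a = a * b / (a + b) := by ring
  have e2 : a / (a + b) * b = a * b / (a + b) := by ring
  rw [e1, e2]; abel

theorem Le.smul_left {x y : E} {c : ℝ} (hc : 0 < c) (h1 : Le K x y) : Le K (c • x) y := by
  obtain ⟨a, ha, h1⟩ := h1
  refine ⟨a / c, by positivity, ?_⟩
  rw [smul_smul, div_mul_cancel₀ _ hc.ne']; exact h1

theorem Le.smul_right {x y : E} {c : ℝ} (hc : 0 < c) (h1 : Le K x y) : Le K x (c • y) := by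
  obtain ⟨a, ha, h1⟩ := h1
  refine ⟨c * a, by positivity, ?_⟩
  have := h.smul c hc.le _ h1
  convert this using 1
  module

theorem Le.mem_O {x y : E} (hx : x ∈ O) (h1 : Le K x y) : y ∈ O := by
  obtain ⟨a, ha, h1⟩ := h1
  have := h.addO _ (h.smulO a ha x hx) _ h1
  simpa using this

theorem le_of_mem_O {x y : E} (hx : x ∈ O) : Le K y x := by
  have hc : ContinuousAt (fun t : ℝ => x - t • y) 0 := by fun_prop
  have hm : O ∈ nhds (x - (0 : ℝ) • y) := by
    simpa using h.openO.mem_nhds hx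
  have := hc.preimage_mem_nhds hm
  obtain ⟨ε, hε, hb⟩ := Metric.mem_nhds_iff.1 this
  refine ⟨ε / 2, by positivity, h.sub ?_⟩
  have hmem : ε / 2 ∈ Metric.ball (0 : ℝ) ε := by
    rw [Metric.mem_ball, Real.dist_eq, sub_zero, abs_of_pos (by positivity)]
    linarith
  exact hb hmem

theorem le_add_self {x y : E} (hx : x ∈ K) (hy : y ∈ K) : Le K x (x + y) :=
  Le.of_sub h (by simpa using hy)

theorem le_self_add {x y : E} (hx : x ∈ K) (hy : y ∈ K) : Le K y (x + y) :=
  Le.of_sub h (by simpa using hx)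

theorem Eqv.symm' {x y : E} (h1 : Eqv K x y) : Eqv K y x := ⟨h1.2, h1.1⟩

theorem Eqv.trans' {x y z : E} (h1 : Eqv K x y) (h2 : Eqv K y z) : Eqv K x z :=
  ⟨Le.trans' h h1.1 h2.1, Le.trans' h h2.2 h1.2⟩

theorem Eqv.smul' {x : E} {c : ℝ} (hc : 0 < c) (hx : x ∈ K) : Eqv K (c • x) x :=
  ⟨Le.smul_left h hc (Le.refl' h hx), Le.smul_right h hc (Le.refl' h hx)⟩

end

structure FullHyp (K O Q : Set E) (f : E →ₗ[ℝ] ℝ) (M : ℝ) : Prop extends ConeHyp K O f M where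
  Qsub : Q ⊆ K
  Qadd : ∀ x ∈ Q, ∀ y ∈ Q, x + y ∈ Q
  Qsmul : ∀ c : ℝ, 0 ≤ c → ∀ x ∈ Q, c • x ∈ Q
  Qclosed : IsClosed Q
  H : ∀ x ∈ Q, x ≠ 0 → x ∉ O → ∃ (φ : E →ₗ[ℝ] ℝ) (ε : ℝ) (e₁ e₂ : E), 0 < ε ∧
    (∀ y ∈ K, y ≠ 0 → Le K y x → 0 < φ y) ∧
    ∀ y ∈ Q, Le K y x → ¬ Le K x y → φ y = 1 →
      (y - ε • e₁ ∈ K ∧ e₁ - ε • y ∈ K) ∨ (y - ε • e₂ ∈ K ∧ e₂ - ε • y ∈ K)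
  B : ∀ (p : ℕ → E) (v : E), (∀ n, p n ∈ Q) → (∀ n, p n ∈ O) → Tendsto p atTop (nhds v) →
    v ≠ 0 → v ∈ K → v ∉ O → ∃ (G : ℕ → E →ₗ[ℝ] E) (ψ : ℕ → ℕ) (q : E), StrictMono ψ ∧
      (∀ n, ∀ x ∈ K, G n x ∈ K) ∧ (∀ n, ∀ x ∈ Q, G n x ∈ Q) ∧
      (∀ n, ∀ x ∈ K, x ∉ O → G n x ∉ O) ∧ q ∈ O ∧
      Tendsto (fun n => G n (p (ψ n))) atTop (nhds q) ∧
      ∀ m ∈ O, ∀ (r : ℕ → ℝ) (θ : E) (χ : ℕ → ℕ), StrictMono χ →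
        Tendsto (fun n => r n • G (χ n) m) atTop (nhds θ) → θ ∉ O

section
variable (h : FullHyp K O Q f M)
include h

theorem pigeon {x y₁ y₂ y₃ : E} (hx : x ∈ Q) (hx0 : x ≠ 0) (hxO : x ∉ O)
    (h1 : y₁ ∈ Q) (h2 : y₂ ∈ Q) (h3 : y₃ ∈ Q) (n1 : y₁ ≠ 0) (n2 : y₂ ≠ 0) (n3 : y₃ ≠ 0)
    (l1 : Le K y₁ x) (l2 : Le K y₂ x) (l3 : Le K y₃ x)
    (m1 : ¬ Le K x y₁) (m2 : ¬ Le K x y₂) (m3 : ¬ Le K x y₃) :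
    Eqv K y₁ y₂ ∨ Eqv K y₁ y₃ ∨ Eqv K y₂ y₃ := by
  have hh := h.toConeHyp
  obtain ⟨φ, ε, e₁, e₂, hε, hφ, H⟩ := h.H x hx hx0 hxO
  have key : ∀ y ∈ Q, y ≠ 0 → Le K y x → ¬ Le K x y → Eqv K y e₁ ∨ Eqv K y e₂ := by
    intro y hy hy0 hl hm
    have hp := hφ y (h.Qsub hy) hy0 hl
    have hc : 0 < (φ y)⁻¹ := inv_pos.2 hp
    have heq := Eqv.smul' hh hc (h.Qsub hy)
    have := H ((φ y)⁻¹ • y) (h.Qsmul _ hc.le _ hy) (Le.trans' hh heq.1 hl)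
      (fun h' => hm (Le.trans' hh h' heq.1)) (by simp [hp.ne'])
    rcases this with ⟨a, b⟩ | ⟨a, b⟩
    · exact Or.inl (Eqv.trans' hh (Eqv.symm' hh heq) ⟨⟨ε, hε, b⟩, ⟨ε, hε, a⟩⟩)
    · exact Or.inr (Eqv.trans' hh (Eqv.symm' hh heq) ⟨⟨ε, hε, b⟩, ⟨ε, hε, a⟩⟩)
  have k1 := key _ h1 n1 l1 m1
  have k2 := key _ h2 n2 l2 m2
  have k3 := key _ h3 n3 l3 m3
  have T : ∀ {a b c : E}, Eqv K a c → Eqv K b c → Eqv K a b := fun u v =>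
    Eqv.trans' hh u (Eqv.symm' hh v)
  rcases k1 with k1 | k1 <;> rcases k2 with k2 | k2 <;> rcases k3 with k3 | k3
  · exact Or.inl (T k1 k2)
  · exact Or.inl (T k1 k2)
  · exact Or.inr (Or.inl (T k1 k3))
  · exact Or.inr (Or.inr (T k2 k3))
  · exact Or.inr (Or.inr (T k2 k3))
  · exact Or.inr (Or.inl (T k1 k3))
  · exact Or.inl (T k1 k2)
  · exact Or.inl (T k1 k2)

theorem bounded_face {x v w : E} (hx : x ∈ Q) (hx0 : x ≠ 0) (hxO : x ∉ O)
    (hv : v ∈ Q) (hw : w ∈ Q) (hv0 : v ≠ 0)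
    (hl : Le K (v + w) x) (hnl : ¬ Le K w v) : Le K x (v + w) := by
  have hh := h.toConeHyp
  by_contra hm
  apply hnl
  obtain ⟨φ, ε, e₁, e₂, hε, hφ, H⟩ := h.H x hx hx0 hxO
  have hvK := h.Qsub hv
  have hwK := h.Qsub hw
  have hvx : Le K v x := Le.trans' hh (le_add_self hh hvK hwK) hl
  have hwx : Le K w x := Le.trans' hh (le_self_add hh hvK hwK) hl
  have hφv := hφ v hvK hv0 hvx
  -- sequence
  let t : ℕ → ℝ := fun n => 1 / ((n : ℝ) + 1)
  have ht : ∀ n, 0 < t n := fun n => by positivity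
  have ht0 : Tendsto t atTop (nhds 0) := tendsto_one_div_add_atTop_nhds_zero_nat
  let z : ℕ → E := fun n => v + t n • w
  have hzQ : ∀ n, z n ∈ Q := fun n => h.Qadd _ hv _ (h.Qsmul _ (ht n).le _ hw)
  have hzx : ∀ n, Le K (z n) x := fun n =>
    Le.add_le hh hvx (Le.smul_left hh (ht n) hwx)
  have hwz : ∀ n, Le K w (z n) := fun n =>
    Le.add_left hh (Le.smul_right hh (ht n) (Le.refl' hh hwK)) hvK
  have hvz : ∀ n, Le K v (z n) := fun n =>
    Le.add_right hh (Le.refl' hh hvK) (h.smul _ (ht n).le _ hwK)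
  have hzvw : ∀ n, Le K (z n) (v + w) := fun n =>
    Le.add_le hh (le_add_self hh hvK hwK) (Le.smul_left hh (ht n) (le_self_add hh hvK hwK))
  have hz0 : ∀ n, z n ≠ 0 := by
    intro n hn
    have h1 := hh.fpos v hvK hv0
    have h2 : 0 ≤ f w := by
      by_cases hw0 : w = 0
      · simp [hw0]
      · exact (hh.fpos w hwK hw0).le
    have : f (z n) = f v + t n * f w := by simp [z]
    rw [hn, map_zero] at this
    have := mul_nonneg (ht n).le h2
    linarith
  have hφz : ∀ n, 0 < φ (z n) := fun n => hφ _ (h.Qsub (hzQ n)) (hz0 n) (hzx n)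
  have hzt : Tendsto z atTop (nhds v) := by
    have : Tendsto (fun n => v + t n • w) atTop (nhds (v + (0 : ℝ) • w)) :=
      tendsto_const_nhds.add (ht0.smul_const w)
    simpa using this
  have hφzt : Tendsto (fun n => φ (z n)) atTop (nhds (φ v)) := by
    have : Tendsto (fun n => φ v + t n * φ w) atTop (nhds (φ v + 0 * φ w)) :=
      tendsto_const_nhds.add (ht0.mul_const _)
    simpa [z] using this
  let y : ℕ → E := fun n => (φ (z n))⁻¹ • z n
  have hyt : Tendsto y atTop (nhds ((φ v)⁻¹ • v)) := (hφzt.inv₀ hφv.ne').smul hzt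
  have hc : ∀ n, 0 < (φ (z n))⁻¹ := fun n => inv_pos.2 (hφz n)
  have heq : ∀ n, Eqv K (y n) (z n) := fun n => Eqv.smul' hh (hc n) (h.Qsub (hzQ n))
  have hH : ∀ n, (y n - ε • e₁ ∈ K ∧ e₁ - ε • y n ∈ K) ∨ (y n - ε • e₂ ∈ K ∧ e₂ - ε • y n ∈ K) := by
    intro n
    refine H (y n) (h.Qsmul _ (hc n).le _ (hzQ n)) (Le.trans' hh (heq n).1 (hzx n)) ?_
      (by simp [y, (hφz n).ne'])
    intro h'
    exact hm (Le.trans' hh h' (Le.trans' hh (heq n).1 (hzvw n)))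
  have fin : ∀ e : E, (∃ᶠ n in atTop, (y n - ε • e ∈ K ∧ e - ε • y n ∈ K)) → Le K w v := by
    intro e he
    have c1 : (φ v)⁻¹ • v - ε • e ∈ K := by
      refine h.closed.mem_of_frequently_of_tendsto (he.mono fun n hn => hn.1)
        (hyt.sub_const _)
    obtain ⟨n, -, hn⟩ := he.exists
    have a1 : Le K e ((φ v)⁻¹ • v) := ⟨ε, hε, c1⟩
    have a2 : Le K (y n) e := ⟨ε, hε, hn⟩
    exact Le.trans' hh (Le.trans' hh (hwz n) (heq n).2)
      (Le.trans' hh a2 (Le.trans' hh a1 (Eqv.smul' hh (inv_pos.2 hφv) hvK).1))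
  have hfr : ∃ᶠ n in atTop, ((y n - ε • e₁ ∈ K ∧ e₁ - ε • y n ∈ K) ∨
      (y n - ε • e₂ ∈ K ∧ e₂ - ε • y n ∈ K)) := Frequently.of_forall hH
  rcases frequently_or_distrib.1 hfr with h1 | h1
  · exact fin _ h1
  · exact fin _ h1

end

/-- A properly embedded triangle, in terms of lifts of its vertices. -/
structure Tri (K O Q : Set E) (a b c : E) : Prop where
  ha : a ∈ Q
  hb : b ∈ Q
  hc : c ∈ Q
  abc : a + b + c ∈ O
  ab : a + b ∉ O
  ac : a + c ∉ O
  bc : b + c ∉ O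

theorem Tri.perm1 {a b c : E} (t : Tri K O Q a b c) : Tri K O Q b a c :=
  ⟨t.hb, t.ha, t.hc, by rw [add_comm b a]; exact t.abc, by rw [add_comm]; exact t.ab, t.bc, t.ac⟩

theorem Tri.perm2 {a b c : E} (t : Tri K O Q a b c) : Tri K O Q a c b :=
  ⟨t.ha, t.hc, t.hb, by rw [add_right_comm]; exact t.abc, t.ac, t.ab, by
    rw [add_comm]; exact t.bc⟩

section
variable (h : FullHyp K O Q f M)
include h

theorem Tri.not_le {a b c : E} (t : Tri K O Q a b c) : ¬ Le K b a := by
  have hh := h.toConeHyp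
  intro hl
  apply t.ac
  have ha := h.Qsub t.ha
  have hc := h.Qsub t.hc
  exact Le.mem_O hh t.abc (Le.add_le hh (Le.add_le hh (le_add_self hh ha hc)
    (Le.add_right hh hl hc)) (le_self_add hh ha hc))

theorem Tri.ne0 {a b c : E} (t : Tri K O Q a b c) : a ≠ 0 := by
  rintro rfl
  have := t.abc
  rw [zero_add] at this
  exact t.bc this

theorem add_ne0 {a b : E} (ha : a ∈ K) (hb : b ∈ K) (ha0 : a ≠ 0) : a + b ≠ 0 := by
  intro h0
  have h1 := h.fpos a ha ha0
  have h2 : 0 ≤ f b := by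
    by_cases hw0 : b = 0
    · simp [hw0]
    · exact (h.fpos b hb hw0).le
  have := congrArg f h0
  simp at this
  linarith

/-- case (b) -/
theorem no_vertex_edge {a b c a' b' c' : E} (t : Tri K O Q a b c) (t' : Tri K O Q a' b' c')
    (he : Eqv K a (a' + b')) : False := by
  have hh := h.toConeHyp
  have ha := h.Qsub t.ha
  have hb := h.Qsub t.hb
  have := bounded_face h (h.Qadd _ t.ha _ t.hb) (add_ne0 h ha hb (t.ne0 h)) t.ab t'.ha t'.hb
    (t'.ne0 h) (Le.add_right hh he.2 hb) (t'.not_le h)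
  exact t.not_le h (Le.trans' hh (le_self_add hh ha hb) (Le.trans' hh this he.2))

/-- case (a) -/
theorem edge_edge {a b c a' b' c' : E} (t : Tri K O Q a b c) (t' : Tri K O Q a' b' c')
    (he : Eqv K (a + b) (a' + b')) : Eqv K a a' ∨ Eqv K b a' := by
  have hh := h.toConeHyp
  have ha := h.Qsub t.ha
  have hb := h.Qsub t.hb
  have ha' := h.Qsub t'.ha
  have hb' := h.Qsub t'.hb
  have := pigeon h (h.Qadd _ t.ha _ t.hb) (add_ne0 h ha hb (t.ne0 h)) t.ab t.ha t.hb t'.ha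
    (t.ne0 h) (t.perm1.ne0 h) (t'.ne0 h) (le_add_self hh ha hb) (le_self_add hh ha hb)
    (Le.trans' hh (le_add_self hh ha' hb') he.2)
    (fun h' => t.not_le h (Le.trans' hh (le_self_add hh ha hb) h'))
    (fun h' => t.perm1.not_le h (Le.trans' hh (le_add_self hh ha hb) h'))
    (fun h' => t'.not_le h (Le.trans' hh (le_self_add hh ha' hb') (Le.trans' hh he.2 h')))
  rcases this with h1 | h1 | h1
  · exact absurd h1.2 (t.not_le h)
  · exact Or.inl h1
  · exact Or.inr h1

/-- no ideal triangle in a face -/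
theorem no_config {v a b c : E} (hv : v ∈ Q) (ha : a ∈ Q) (hb : b ∈ Q) (hc : c ∈ Q)
    (va : v + a ∉ O) (vb : v + b ∉ O) (vc : v + c ∉ O) (vab : v + a + b ∈ O)
    (vac : v + a + c ∈ O) (vbc : v + b + c ∈ O) (abc : a + b + c ∉ O) : False := by
  have hh := h.toConeHyp
  have ha' := h.Qsub ha
  have hb' := h.Qsub hb
  have hc' := h.Qsub hc
  have ab : a + b ∉ O := fun h' => abc (h.addO _ h' _ hc')
  have ac : a + c ∉ O := fun h' => abc (by rw [add_right_comm]; exact h.addO _ h' _ hb')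
  have bc : b + c ∉ O := fun h' => abc (by
    have := h.addO _ h' _ ha'
    convert this using 1; abel)
  have t1 : Tri K O Q v a b := ⟨hv, ha, hb, vab, va, vb, ab⟩
  have t2 : Tri K O Q v a c := ⟨hv, ha, hc, vac, va, vc, ac⟩
  have t3 : Tri K O Q v b c := ⟨hv, hb, hc, vbc, vb, vc, bc⟩
  have ba : ¬ Le K b a := t1.perm1.perm2.not_le h
  have ca : ¬ Le K c a := t2.perm1.perm2.not_le h
  have cb : ¬ Le K c b := t3.perm1.perm2.not_le h
  have bc : ¬ Le K b c := t3.perm2.perm1.perm2.not_le h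
  have lb : Le K b (a + b + c) := Le.add_right hh (le_self_add hh ha' hb') hc'
  have lc : Le K c (a + b + c) := le_self_add hh (h.add _ ha' _ hb') hc'
  have := pigeon h (h.Qadd _ (h.Qadd _ ha _ hb) _ hc)
    (by rw [add_assoc]; exact add_ne0 h ha' (h.add _ hb' _ hc') (t1.perm1.ne0 h)) abc
    ha hb hc (t1.perm1.ne0 h) (t3.perm1.ne0 h) (t3.perm2.perm1.ne0 h)
    (Le.add_right hh (le_add_self hh ha' hb') hc') lb lc
    (fun h' => ba (Le.trans' hh lb h')) (fun h' => cb (Le.trans' hh lc h'))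
    (fun h' => bc (Le.trans' hh lb h'))
  rcases this with h1 | h1 | h1
  · exact ba h1.2
  · exact ca h1.2
  · exact cb h1.2

theorem not_O_add_smul {v a : E} {t : ℝ} (ht : 0 < t) (hv : v ∈ K) (ha : a ∈ K)
    (hO : v + a ∉ O) : v + t • a ∉ O := by
  have hh := h.toConeHyp
  intro h'
  exact hO (Le.mem_O hh h' (Le.add_le hh (le_add_self hh hv ha)
    (Le.smul_left hh ht (le_self_add hh hv ha))))

/-- blow up -/
theorem blowup [ProperSpace E] [FiniteDimensional ℝ E] {v a b c : E} (hv : v ∈ Q) (ha : a ∈ Q) (hb : b ∈ Q) (hc : c ∈ Q)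
    (va : v + a ∉ O) (vb : v + b ∉ O) (vc : v + c ∉ O) (vab : v + a + b ∈ O)
    (vac : v + a + c ∈ O) (vbc : v + b + c ∈ O) (v0 : v ≠ 0) : False := by
  have hh := h.toConeHyp
  have hv' := h.Qsub hv
  have ha' := h.Qsub ha
  have hb' := h.Qsub hb
  have hc' := h.Qsub hc
  have vO : v ∉ O := fun h' => va (h.addO _ h' _ ha')
  let t : ℕ → ℝ := fun n => 1 / ((n : ℝ) + 1)
  have ht : ∀ n, 0 < t n := fun n => by positivity
  have ht1 : ∀ n, t n ≤ 1 := fun n => by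
    simp only [t]; rw [div_le_one (by positivity)]; have : (0:ℝ) ≤ n := by positivity
    linarith
  have ht0 : Tendsto t atTop (nhds 0) := tendsto_one_div_add_atTop_nhds_zero_nat
  let m := a + b + c
  have hm : m ∈ Q := h.Qadd _ (h.Qadd _ ha _ hb) _ hc
  let p : ℕ → E := fun n => v + t n • m
  have hp : Tendsto p atTop (nhds v) := by
    have : Tendsto (fun n => v + t n • m) atTop (nhds (v + (0 : ℝ) • m)) :=
      tendsto_const_nhds.add (ht0.smul_const m)
    simpa using this
  have hpQ : ∀ n, p n ∈ Q := fun n => h.Qadd _ hv _ (h.Qsmul _ (ht n).le _ hm)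
  have hpO : ∀ n, p n ∈ O := by
    intro n
    by_contra h'
    have := not_O_add_smul h (t := (t n)⁻¹) (inv_pos.2 (ht n)) hv' (h.smul _ (ht n).le _ (h.Qsub hm)) h'
    rw [smul_smul, inv_mul_cancel₀ (ht n).ne', one_smul] at this
    apply this
    have := h.addO _ vab _ hc'
    convert this using 1; simp only [m]; abel
  obtain ⟨G, ψ, q, hψ, GK, GQ, GO, hq, hlim, hpr⟩ := h.B p v hpQ hpO hp v0 hv' vO
  let W : ℕ → E := fun n => G n v
  let A : ℕ → E := fun n => G n (t (ψ n) • a)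
  let B : ℕ → E := fun n => G n (t (ψ n) • b)
  let D : ℕ → E := fun n => G n (t (ψ n) • c)
  have hsum : ∀ n, G n (p (ψ n)) = W n + A n + B n + D n := by
    intro n
    simp only [p, m, W, A, B, D, ← map_add]
    congr 1; module
  have tq : ∀ n, 0 ≤ t (ψ n) := fun n => (ht _).le
  have WQ : ∀ n, W n ∈ Q := fun n => GQ n _ hv
  have AQ : ∀ n, A n ∈ Q := fun n => GQ n _ (h.Qsmul _ (tq n) _ ha)
  have BQ : ∀ n, B n ∈ Q := fun n => GQ n _ (h.Qsmul _ (tq n) _ hb)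
  have DQ : ∀ n, D n ∈ Q := fun n => GQ n _ (h.Qsmul _ (tq n) _ hc)
  have fnn : ∀ x ∈ Q, 0 ≤ f x := by
    intro x hx
    by_cases hw0 : x = 0
    · simp [hw0]
    · exact (h.fpos x (h.Qsub hx) hw0).le
  have fc : Continuous f := LinearMap.continuous_of_finiteDimensional f
  have fb : Tendsto (fun n => f (G n (p (ψ n)))) atTop (nhds (f q)) :=
    (fc.tendsto q).comp hlim
  obtain ⟨R, hR⟩ := fb.bddAbove_range
  have hR' : ∀ n, f (W n) + f (A n) + f (B n) + f (D n) ≤ R := by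
    intro n
    have := hR ⟨n, rfl⟩
    simpa only [hsum, map_add] using this
  have M0 : ∀ x ∈ Q, f x ≤ R → ‖x‖ ≤ |M| * |R| := by
    intro x hx hx'
    have h1 := h.bound x (h.Qsub hx)
    have h2 := fnn x hx
    calc ‖x‖ ≤ M * f x := h1
      _ ≤ |M| * f x := by gcongr; exact le_abs_self M
      _ ≤ |M| * |R| := by gcongr; exact hx'.trans (le_abs_self R)
  have bW : ∀ n, ‖W n‖ ≤ |M| * |R| := fun n => M0 _ (WQ n) (by
    linarith [hR' n, fnn _ (AQ n), fnn _ (BQ n), fnn _ (DQ n)])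
  have bA : ∀ n, ‖A n‖ ≤ |M| * |R| := fun n => M0 _ (AQ n) (by
    linarith [hR' n, fnn _ (WQ n), fnn _ (BQ n), fnn _ (DQ n)])
  have bB : ∀ n, ‖B n‖ ≤ |M| * |R| := fun n => M0 _ (BQ n) (by
    linarith [hR' n, fnn _ (AQ n), fnn _ (WQ n), fnn _ (DQ n)])
  have bD : ∀ n, ‖D n‖ ≤ |M| * |R| := fun n => M0 _ (DQ n) (by
    linarith [hR' n, fnn _ (AQ n), fnn _ (BQ n), fnn _ (WQ n)])
  have hcpt := isCompact_closedBall (0 : E × E × E × E) (|M| * |R|)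
  obtain ⟨⟨v₁, a₁, b₁, c₁⟩, -, χ, hχ, hconv⟩ := hcpt.tendsto_subseq
    (x := fun n => (W n, A n, B n, D n)) (by
      intro n
      rw [mem_closedBall_zero_iff, norm_prod_le_iff, norm_prod_le_iff, norm_prod_le_iff]
      exact ⟨bW n, bA n, bB n, bD n⟩)
  have lW : Tendsto (fun n => W (χ n)) atTop (nhds v₁) := (continuous_fst.tendsto _).comp hconv
  have lA : Tendsto (fun n => A (χ n)) atTop (nhds a₁) :=
    ((continuous_fst.comp continuous_snd).tendsto _).comp hconv
  have lB : Tendsto (fun n => B (χ n)) atTop (nhds b₁) :=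
    ((continuous_fst.comp (continuous_snd.comp continuous_snd)).tendsto _).comp hconv
  have lD : Tendsto (fun n => D (χ n)) atTop (nhds c₁) :=
    ((continuous_snd.comp (continuous_snd.comp continuous_snd)).tendsto _).comp hconv
  have qs : v₁ + a₁ + b₁ + c₁ = q := by
    refine tendsto_nhds_unique (((lW.add lA).add lB).add lD) ?_
    have := hlim.comp hχ.tendsto_atTop
    refine this.congr fun n => ?_
    simp only [Function.comp, hsum]
  have v₁Q : v₁ ∈ Q := h.Qclosed.mem_of_tendsto lW (Eventually.of_forall fun n => WQ _)
  have a₁Q : a₁ ∈ Q := h.Qclosed.mem_of_tendsto lA (Eventually.of_forall fun n => AQ _)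
  have b₁Q : b₁ ∈ Q := h.Qclosed.mem_of_tendsto lB (Eventually.of_forall fun n => BQ _)
  have c₁Q : c₁ ∈ Q := h.Qclosed.mem_of_tendsto lD (Eventually.of_forall fun n => DQ _)
  have clO : IsClosed Oᶜ := h.openO.isClosed_compl
  have edge : ∀ {x x₁ : E}, x ∈ Q → v + x ∉ O →
      Tendsto (fun n => G (χ n) (t (ψ (χ n)) • x)) atTop (nhds x₁) → v₁ + x₁ ∉ O := by
    intro x x₁ hx hvx hl
    refine clO.mem_of_tendsto (lW.add hl) (Eventually.of_forall fun n => ?_)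
    simp only [W, ← map_add, mem_compl_iff]
    exact GO _ _ (h.add _ hv' _ (h.smul _ (ht _).le _ (h.Qsub hx)))
      (not_O_add_smul h (ht _) hv' (h.Qsub hx) hvx)
  have inter : ∀ {x y z x₁ y₁ z₁ : E}, x ∈ Q → y ∈ Q → z ∈ Q → x₁ ∈ Q → y₁ ∈ Q → z₁ ∈ Q →
      v + x + y ∈ O →
      Tendsto (fun n => G (χ n) (t (ψ (χ n)) • x)) atTop (nhds x₁) →
      Tendsto (fun n => G (χ n) (t (ψ (χ n)) • y)) atTop (nhds y₁) →
      Tendsto (fun n => G (χ n) (t (ψ (χ n)) • z)) atTop (nhds z₁) →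
      v₁ + x₁ + y₁ + z₁ = q → v₁ + x₁ + y₁ ∈ O := by
    intro x y z x₁ y₁ z₁ hx hy hz hx1 hy1 hz1 hO lx ly lz hq1
    obtain ⟨ε, hε, hεK⟩ := le_of_mem_O hh (y := z) hO
    have hle : Le K z₁ (v₁ + x₁ + y₁) := by
      refine ⟨ε, hε, ?_⟩
      refine h.closed.mem_of_tendsto (((lW.add lx).add ly).sub (lz.const_smul ε))
        (Eventually.of_forall fun n => ?_)
      simp only [W, ← map_add, ← map_smul, ← map_sub]
      apply GK
      have := h.add _ (h.smul (1 - t (ψ (χ n))) (by linarith [ht1 (ψ (χ n))]) _ hv')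
        _ (h.smul _ (ht (ψ (χ n))).le _ hεK)
      convert this using 1
      module
    rw [← hq1] at hq
    exact Le.mem_O hh hq (Le.add_le hh (Le.refl' hh (h.Qsub (h.Qadd _ (h.Qadd _ v₁Q _ hx1) _ hy1)))
      hle)
  refine no_config h v₁Q a₁Q b₁Q c₁Q (edge ha va lA) (edge hb vb lB) (edge hc vc lD)
    (inter ha hb hc a₁Q b₁Q c₁Q vab lA lB lD qs)
    (inter ha hc hb a₁Q c₁Q b₁Q vac lA lD lB (by rw [← qs]; abel))
    (inter hb hc ha b₁Q c₁Q a₁Q vbc lB lD lA (by rw [← qs]; abel)) ?_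
  have lm : Tendsto (fun n => t (ψ (χ n)) • G (χ n) m) atTop (nhds (a₁ + b₁ + c₁)) := by
    refine ((lA.add lB).add lD).congr fun n => ?_
    simp only [A, B, D, m, map_smul, map_add, smul_add]
  by_cases hmO : m ∈ O
  · exact hpr m hmO _ _ χ hχ lm
  · refine clO.mem_of_tendsto lm (Eventually.of_forall fun n => ?_)
    rw [← map_smul]
    refine GO _ _ (h.smul _ (ht _).le _ (h.Qsub hm)) ?_
    intro h'
    apply hmO
    have := h.smulO _ (inv_pos.2 (ht (ψ (χ n)))) _ h'
    rwa [smul_smul, inv_mul_cancel₀ (ht _).ne', one_smul] at this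

theorem common_face {a b c a' b' c' : E} (t : Tri K O Q a b c) (t' : Tri K O Q a' b' c')
    (he : Eqv K a a') (hO : a + b + b' ∉ O) : Eqv K b b' := by
  have hh := h.toConeHyp
  have ha := h.Qsub t.ha
  have hb := h.Qsub t.hb
  have ha' := h.Qsub t'.ha
  have hb' := h.Qsub t'.hb
  have x0 : a + b + b' ≠ 0 := by
    rw [add_assoc]; exact add_ne0 h ha (h.add _ hb _ hb') (t.ne0 h)
  have xQ := h.Qadd _ (h.Qadd _ t.ha _ t.hb) _ t'.hb
  have lab : Le K (a + b) (a + b + b') := le_add_self hh (h.add _ ha _ hb) hb'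
  have la : Le K a (a + b + b') := Le.trans' hh (le_add_self hh ha hb) lab
  have lb : Le K b (a + b + b') := Le.trans' hh (le_self_add hh ha hb) lab
  have lb' : Le K b' (a + b + b') := le_self_add hh (h.add _ ha _ hb) hb'
  have := pigeon h xQ x0 hO t.ha t.hb t'.hb (t.ne0 h) (t.perm1.ne0 h) (t'.perm1.ne0 h)
    la lb lb' (fun h' => t.not_le h (Le.trans' hh lb h'))
    (fun h' => t.perm1.not_le h (Le.trans' hh la h'))
    (fun h' => t'.perm1.not_le h (Le.trans' hh he.2 (Le.trans' hh la h')))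
  rcases this with h1 | h1 | h1
  · exact absurd h1.2 (t.not_le h)
  · exact absurd (Le.trans' hh h1.2 he.1) (t'.not_le h)
  · exact h1

theorem vertex_vertex [ProperSpace E] [FiniteDimensional ℝ E] {a b c a' b' c' : E}
    (t : Tri K O Q a b c) (t' : Tri K O Q a' b' c')
    (he : Eqv K a a') : Eqv K b b' ∨ Eqv K b c' := by
  have hh := h.toConeHyp
  have ha := h.Qsub t.ha
  have hb' := h.Qsub t'.hb
  have hc' := h.Qsub t'.hc
  by_cases h1 : a + b + b' ∈ O
  swap
  · exact Or.inl (common_face h t t' he h1)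
  by_cases h2 : a + b + c' ∈ O
  swap
  · exact Or.inr (common_face h t t'.perm2 he h2)
  exfalso
  refine blowup h t.ha t.hb t'.hb t'.hc t.ab ?_ ?_ h1 h2 ?_ (t.ne0 h)
  · exact fun h' => t'.ab (Le.mem_O hh h' (Le.add_le hh (Le.add_right hh he.1 hb')
      (le_self_add hh (h.Qsub t'.ha) hb')))
  · exact fun h' => t'.ac (Le.mem_O hh h' (Le.add_le hh (Le.add_right hh he.1 hc')
      (le_self_add hh (h.Qsub t'.ha) hc')))
  · refine Le.mem_O hh t'.abc (Le.add_le hh (Le.add_le hh ?_ ?_) ?_)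
    · exact Le.add_right hh (Le.add_right hh he.2 hb') hc'
    · exact Le.add_right hh (le_self_add hh ha hb') hc'
    · exact le_self_add hh (h.add _ ha _ hb') hc'

theorem Tri.all {u : Fin 3 → E} (t : Tri K O Q (u 0) (u 1) (u 2)) (i j : Fin 3) (hij : i ≠ j) :
    ∃ k, k ≠ i ∧ k ≠ j ∧ Tri K O Q (u i) (u j) (u k) := by
  fin_cases i <;> fin_cases j
  · exact absurd rfl hij
  · exact ⟨2, by decide, by decide, t⟩
  · exact ⟨1, by decide, by decide, t.perm2⟩
  · exact ⟨2, by decide, by decide, t.perm1⟩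
  · exact absurd rfl hij
  · exact ⟨0, by decide, by decide, t.perm1.perm2⟩
  · exact ⟨1, by decide, by decide, t.perm2.perm1⟩
  · exact ⟨0, by decide, by decide, t.perm2.perm1.perm2⟩
  · exact absurd rfl hij

theorem parallel_of_vertex [ProperSpace E] [FiniteDimensional ℝ E] {u w : Fin 3 → E}
    (t : Tri K O Q (u 0) (u 1) (u 2))
    (t' : Tri K O Q (w 0) (w 1) (w 2)) {i i' : Fin 3} (he : Eqv K (u i) (w i')) :
    ∃ τ : Equiv.Perm (Fin 3), ∀ j, Eqv K (u j) (w (τ j)) := by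
  have hh := h.toConeHyp
  have ex : ∀ j, ∃ j', Eqv K (u j) (w j') := by
    intro j
    by_cases hj : i = j
    · subst hj; exact ⟨i', he⟩
    obtain ⟨k, -, -, t1⟩ := Tri.all h t i j hj
    obtain ⟨j', hj'⟩ : ∃ j', i' ≠ j' := (exists_ne i').imp fun _ h => h.symm
    obtain ⟨k', -, -, t2⟩ := Tri.all h t' i' j' hj'
    rcases vertex_vertex h t1 t2 he with h1 | h1
    · exact ⟨_, h1⟩
    · exact ⟨_, h1⟩
  choose τ hτ using ex
  have inj : Function.Injective τ := by
    intro j k hjk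
    by_contra hne
    obtain ⟨l, -, -, t1⟩ := Tri.all h t j k hne
    have h1 := hτ j
    rw [hjk] at h1
    exact t1.not_le h (Le.trans' hh (hτ k).1 h1.2)
  exact ⟨Equiv.ofBijective τ (Finite.injective_iff_bijective.1 inj), hτ⟩

/-- main abstract result -/
theorem main [ProperSpace E] [FiniteDimensional ℝ E] {u w : Fin 3 → E}
    (t : Tri K O Q (u 0) (u 1) (u 2))
    (t' : Tri K O Q (w 0) (w 1) (w 2)) {x y : E} (hxy : Eqv K x y)
    (hx : (∃ i, Eqv K x (u i)) ∨ ∃ i j, i ≠ j ∧ Eqv K x (u i + u j))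
    (hy : (∃ i, Eqv K y (w i)) ∨ ∃ i j, i ≠ j ∧ Eqv K y (w i + w j)) :
    ∃ τ : Equiv.Perm (Fin 3), ∀ j, Eqv K (u j) (w (τ j)) := by
  have hh := h.toConeHyp
  have T : ∀ {a b : E}, Eqv K x a → Eqv K y b → Eqv K a b := fun p q =>
    Eqv.trans' hh (Eqv.symm' hh p) (Eqv.trans' hh hxy q)
  rcases hx with ⟨i, hi⟩ | ⟨i, j, hij, hi⟩ <;> rcases hy with ⟨k, hk⟩ | ⟨k, l, hkl, hk⟩
  · exact parallel_of_vertex h t t' (T hi hk)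
  · exfalso
    obtain ⟨j, hj⟩ : ∃ j, i ≠ j := (exists_ne i).imp fun _ h => h.symm
    obtain ⟨_, -, -, t1⟩ := Tri.all h t i j hj
    obtain ⟨_, -, -, t2⟩ := Tri.all h t' k l hkl
    exact no_vertex_edge h t1 t2 (T hi hk)
  · exfalso
    obtain ⟨l, hl⟩ : ∃ l, k ≠ l := (exists_ne k).imp fun _ h => h.symm
    obtain ⟨_, -, -, t1⟩ := Tri.all h t i j hij
    obtain ⟨_, -, -, t2⟩ := Tri.all h t' k l hl
    exact no_vertex_edge h t2 t1 (Eqv.symm' hh (T hi hk))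
  · obtain ⟨_, -, -, t1⟩ := Tri.all h t i j hij
    obtain ⟨_, -, -, t2⟩ := Tri.all h t' k l hkl
    rcases edge_edge h t1 t2 (T hi hk) with h1 | h1
    · exact parallel_of_vertex h t t' h1
    · exact parallel_of_vertex h t t' h1

end

end Core

open Core

theorem isOpen_lift {U : Set (PSpace d)} (hU : IsOpen U) :
    IsOpen {v : Fin d → ℝ | ∃ h : v ≠ 0, Projectivization.mk ℝ v h ∈ U} := by
  have hc : Continuous (fun v : {v : Fin d → ℝ // v ≠ 0} => (Projectivization.mk ℝ v.1 v.2 : PSpace d)) :=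
    continuous_quotient_mk'
  have h1 := hU.preimage hc
  have h2 : IsOpen {v : Fin d → ℝ | v ≠ 0} := isOpen_ne
  have := h2.isOpenMap_subtype_val _ h1
  convert this using 1
  ext v
  simp

theorem isOpen_mk {N : Set (Fin d → ℝ)} (hN : IsOpen N) :
    IsOpen {q : PSpace d | ∃ u ∈ N, ∃ h : u ≠ 0, q = Projectivization.mk ℝ u h} := by
  have hq : Topology.IsQuotientMap (fun v : {v : Fin d → ℝ // v ≠ 0} =>
    (Projectivization.mk ℝ v.1 v.2 : PSpace d)) := isQuotientMap_quotient_mk'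
  rw [← hq.isOpen_preimage]
  have : (fun v : {v : Fin d → ℝ // v ≠ 0} => (Projectivization.mk ℝ v.1 v.2 : PSpace d)) ⁻¹'
      {q : PSpace d | ∃ u ∈ N, ∃ h : u ≠ 0, q = Projectivization.mk ℝ u h} =
      ⋃ c : ℝˣ, {v | (c : ℝ) • v.1 ∈ N} := by
    ext ⟨v, hv⟩
    simp only [mem_preimage, mem_setOf_eq, mem_iUnion]
    constructor
    · rintro ⟨u, hu, h0, he⟩
      rw [Projectivization.mk_eq_mk_iff] at he
      obtain ⟨a, ha⟩ := he
      refine ⟨a⁻¹, ?_⟩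
      have : ((a⁻¹ : ℝˣ) : ℝ) • v = u := by
        rw [← ha]
        exact inv_smul_smul a u
      rw [this]; exact hu
    · rintro ⟨c, hc⟩
      refine ⟨_, hc, smul_ne_zero c.ne_zero hv, ?_⟩
      rw [Projectivization.mk_eq_mk_iff]
      exact ⟨c⁻¹, inv_smul_smul c v⟩
  rw [this]
  refine isOpen_iUnion fun c => ?_
  exact hN.preimage (by fun_prop)

/-- lifts -/
def coneSet (f : (Fin d → ℝ) →ₗ[ℝ] ℝ) (A : Set (PSpace d)) : Set (Fin d → ℝ) :=
  {v | 0 < f v ∧ ∃ h : v ≠ 0, Projectivization.mk ℝ v h ∈ A}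

theorem lin_cont (f : (Fin d → ℝ) →ₗ[ℝ] ℝ) : Continuous f := f.continuous_of_finiteDimensional

theorem mem_closure_coneSet {f : (Fin d → ℝ) →ₗ[ℝ] ℝ} {A : Set (PSpace d)} {v : Fin d → ℝ}
    (hv : v ≠ 0) (hf : 0 < f v) (hm : Projectivization.mk ℝ v hv ∈ closure A) :
    v ∈ closure (coneSet f A) := by
  rw [mem_closure_iff] at hm ⊢
  intro N hN hvN
  have hN' : IsOpen (N ∩ {u | 0 < f u}) := hN.inter (isOpen_lt continuous_const (lin_cont f))
  obtain ⟨q, ⟨u, hu, h0, rfl⟩, hqA⟩ := hm _ (isOpen_mk hN') ⟨v, ⟨hvN, hf⟩, hv, rfl⟩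
  exact ⟨u, hu.1, hu.2, h0, hqA⟩

theorem mk_mem_closure {f : (Fin d → ℝ) →ₗ[ℝ] ℝ} {A : Set (PSpace d)} {v : Fin d → ℝ}
    (hv : v ≠ 0) (hm : v ∈ closure (coneSet f A)) : Projectivization.mk ℝ v hv ∈ closure A := by
  rw [mem_closure_iff] at hm ⊢
  intro U hU hvU
  obtain ⟨u, ⟨h0, hu⟩, -, h0', hA⟩ := hm _ (isOpen_lift hU) ⟨hv, hvU⟩
  exact ⟨_, hu, hA⟩

theorem chartMap_mk (f : (Fin d → ℝ) →ₗ[ℝ] ℝ) {v : Fin d → ℝ} (hv : v ≠ 0) :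
    chartMap f (Projectivization.mk ℝ v hv) = (f v)⁻¹ • v := by
  obtain ⟨a, ha⟩ := Projectivization.exists_smul_eq_mk_rep ℝ v hv
  unfold chartMap
  rw [← ha, Units.smul_def, map_smul, smul_eq_mul, smul_smul, mul_inv, mul_comm (a : ℝ)⁻¹,
    mul_assoc, inv_mul_cancel₀ a.ne_zero, mul_one]

theorem rep_ne_iff (f : (Fin d → ℝ) →ₗ[ℝ] ℝ) {v : Fin d → ℝ} (hv : v ≠ 0) :
    f (Projectivization.mk ℝ v hv).rep ≠ 0 ↔ f v ≠ 0 := by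
  obtain ⟨a, ha⟩ := Projectivization.exists_smul_eq_mk_rep ℝ v hv
  rw [← ha, Units.smul_def, map_smul, smul_eq_mul]
  simp

theorem f_chartMap (f : (Fin d → ℝ) →ₗ[ℝ] ℝ) {q : PSpace d} (h : f q.rep ≠ 0) :
    f (chartMap f q) = 1 := by
  simp [chartMap, h]

theorem mk_smul {v : Fin d → ℝ} (hv : v ≠ 0) {c : ℝ} (hc : c ≠ 0) :
    Projectivization.mk ℝ (c • v) (smul_ne_zero hc hv) = Projectivization.mk ℝ v hv := by
  rw [Projectivization.mk_eq_mk_iff']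
  exact ⟨c, rfl⟩

theorem mk_chartMap (f : (Fin d → ℝ) →ₗ[ℝ] ℝ) {q : PSpace d} (h : chartMap f q ≠ 0) :
    Projectivization.mk ℝ (chartMap f q) h = q := by
  conv_rhs => rw [← q.mk_rep]
  rw [Projectivization.mk_eq_mk_iff']
  exact ⟨_, rfl⟩

theorem mem_coneSet_iff {f : (Fin d → ℝ) →ₗ[ℝ] ℝ} {A : Set (PSpace d)} {v : Fin d → ℝ}
    (hf : 0 < f v) : v ∈ coneSet f A ↔ (f v)⁻¹ • v ∈ chartMap f '' A := by
  have hv : v ≠ 0 := by rintro rfl; simp at hf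
  constructor
  · rintro ⟨_, h0, hA⟩
    exact ⟨_, hA, chartMap_mk f h0⟩
  · rintro ⟨q, hq, he⟩
    refine ⟨hf, hv, ?_⟩
    have h0 : chartMap f q ≠ 0 := by rw [he]; exact smul_ne_zero (inv_ne_zero hf.ne') hv
    have h1 := mk_chartMap f h0
    have h2 : Projectivization.mk ℝ v hv = q := by
      rw [← h1, ← mk_smul hv (inv_ne_zero hf.ne')]
      congr 1
      exact he.symm
    rw [h2]; exact hq

theorem coneSet_smul {f : (Fin d → ℝ) →ₗ[ℝ] ℝ} {A : Set (PSpace d)} {c : ℝ} (hc : 0 < c)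
    {x : Fin d → ℝ} (hx : x ∈ coneSet f A) : c • x ∈ coneSet f A := by
  obtain ⟨h1, h2, h3⟩ := hx
  refine ⟨by simpa using mul_pos hc h1, smul_ne_zero hc.ne' h2, ?_⟩
  rw [mk_smul h2 hc.ne']; exact h3

theorem coneSet_add {f : (Fin d → ℝ) →ₗ[ℝ] ℝ} {A : Set (PSpace d)}
    (hA : Convex ℝ (chartMap f '' A)) {x y : Fin d → ℝ} (hx : x ∈ coneSet f A)
    (hy : y ∈ coneSet f A) : x + y ∈ coneSet f A := by
  have fx := hx.1
  have fy := hy.1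
  have fxy : 0 < f (x + y) := by rw [map_add]; positivity
  rw [mem_coneSet_iff fx] at hx
  rw [mem_coneSet_iff fy] at hy
  rw [mem_coneSet_iff fxy]
  have hs : f x + f y ≠ 0 := by positivity
  have := hA hx hy (a := f x / (f x + f y)) (b := f y / (f x + f y)) (by positivity) (by positivity)
    (by field_simp)
  convert this using 1
  rw [map_add, smul_add, smul_smul, smul_smul]
  congr 2 <;> field_simp

theorem closure_zero {f : (Fin d → ℝ) →ₗ[ℝ] ℝ} {A : Set (PSpace d)}
    (hne : (coneSet f A).Nonempty) : (0 : Fin d → ℝ) ∈ closure (coneSet f A) := by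
  obtain ⟨x, hx⟩ := hne
  have ht0 : Tendsto (fun n : ℕ => (1 / ((n : ℝ) + 1)) • x) atTop (nhds ((0 : ℝ) • x)) :=
    tendsto_one_div_add_atTop_nhds_zero_nat.smul_const x
  rw [zero_smul] at ht0
  exact mem_closure_of_tendsto ht0 (Eventually.of_forall fun n => coneSet_smul (by positivity) hx)

theorem closure_add {f : (Fin d → ℝ) →ₗ[ℝ] ℝ} {A : Set (PSpace d)}
    (hA : Convex ℝ (chartMap f '' A)) {x y : Fin d → ℝ} (hx : x ∈ closure (coneSet f A))
    (hy : y ∈ closure (coneSet f A)) : x + y ∈ closure (coneSet f A) :=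
  map_mem_closure₂ continuous_add hx hy fun _ ha _ hb => coneSet_add hA ha hb

theorem closure_smul {f : (Fin d → ℝ) →ₗ[ℝ] ℝ} {A : Set (PSpace d)}
    (hne : (coneSet f A).Nonempty) {c : ℝ} (hc : 0 ≤ c) {x : Fin d → ℝ}
    (hx : x ∈ closure (coneSet f A)) : c • x ∈ closure (coneSet f A) := by
  rcases hc.eq_or_lt with rfl | hc
  · rw [zero_smul]; exact closure_zero hne
  · exact map_mem_closure (continuous_const_smul c) hx fun a ha => coneSet_smul hc ha

theorem coneSet_nonempty {f : (Fin d → ℝ) →ₗ[ℝ] ℝ} {A : Set (PSpace d)}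
    (hne : A.Nonempty) (hA : ∀ x ∈ A, f x.rep ≠ 0) : (coneSet f A).Nonempty := by
  obtain ⟨q, hq⟩ := hne
  have h1 := f_chartMap f (hA q hq)
  have h0 : chartMap f q ≠ 0 := by intro h; rw [h, map_zero] at h1; exact zero_ne_one h1
  exact ⟨chartMap f q, by rw [h1]; exact one_pos, h0, by rw [mk_chartMap f h0]; exact hq⟩

/-- cone hypotheses -/
theorem coneHyp {f : (Fin d → ℝ) →ₗ[ℝ] ℝ} {Ω : Set (PSpace d)} (ho : IsOpen Ω)
    (hne : Ω.Nonempty) (hf : ∀ x ∈ closure Ω, f x.rep ≠ 0) (hA : Convex ℝ (chartMap f '' Ω))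
    {M : ℝ} (hM : 0 ≤ M) (hb : ∀ x ∈ chartMap f '' Ω, ‖x‖ ≤ M) :
    ConeHyp (closure (coneSet f Ω)) (coneSet f Ω) f M := by
  have hcne := coneSet_nonempty hne fun x hx => hf x (subset_closure hx)
  have hopen : IsOpen (coneSet f Ω) := (isOpen_lt continuous_const (lin_cont f)).inter (isOpen_lift ho)
  have bound : ∀ x ∈ closure (coneSet f Ω), ‖x‖ ≤ M * f x := by
    have hc : IsClosed {x : Fin d → ℝ | ‖x‖ ≤ M * f x} :=
      isClosed_le continuous_norm (continuous_const.mul (lin_cont f))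
    refine closure_minimal ?_ hc
    intro x hx
    have fx := hx.1
    rw [mem_coneSet_iff fx] at hx
    have := hb _ hx
    rw [norm_smul, norm_inv, Real.norm_of_nonneg fx.le, inv_mul_le_iff₀ fx] at this
    rw [mul_comm] at this
    exact this
  refine ⟨closure_zero hcne, fun x hx y hy => closure_add hA hx hy,
    fun c hc x hx => closure_smul hcne hc hx, isClosed_closure, hopen, subset_closure, ?_,
    fun c hc x hx => coneSet_smul hc hx, bound, ?_, ?_⟩
  · intro x hx y hy
    have hcont : ContinuousAt (fun z => x + (y - z)) y := by fun_prop
    have hN : {z | x + (y - z) ∈ coneSet f Ω} ∈ nhds y :=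
      hcont.preimage_mem_nhds (by simpa using hopen.mem_nhds hx)
    obtain ⟨z, hz1, hz2⟩ := mem_closure_iff_nhds.1 hy _ hN
    have := coneSet_add hA hz1 hz2
    convert this using 1; abel
  · intro x hx h0
    have h1 := bound x hx
    have h2 : 0 < ‖x‖ := norm_pos_iff.2 h0
    by_contra h3
    have : M * f x ≤ 0 := mul_nonpos_of_nonneg_of_nonpos hM (not_lt.1 h3)
    linarith
  · intro h
    have := h.1
    simp at this

theorem chartOf_spec {A : Set (PSpace d)} (hA : IsProperlyConvex A) :
    (∀ x ∈ closure A, chartOf A x.rep ≠ 0) ∧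
    Convex ℝ (chartMap (chartOf A) '' A) ∧ Bornology.IsBounded (chartMap (chartOf A) '' A) := by
  unfold chartOf
  rw [dif_pos hA]
  exact hA.choose_spec

/-- every point of the closure has a normalized lift -/
theorem exists_lift {f : (Fin d → ℝ) →ₗ[ℝ] ℝ} {Ω : Set (PSpace d)}
    (hf : ∀ x ∈ closure Ω, f x.rep ≠ 0) {q : PSpace d} (hq : q ∈ closure Ω) :
    ∃ h : chartMap f q ≠ 0, f (chartMap f q) = 1 ∧ Projectivization.mk ℝ (chartMap f q) h = q := by
  have h1 := f_chartMap f (hf q hq)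
  have h0 : chartMap f q ≠ 0 := by intro h; rw [h, map_zero] at h1; exact zero_ne_one h1
  exact ⟨h0, h1, mk_chartMap f h0⟩

section
variable {Ω : Set (PSpace d)} {M : ℝ}
  (hf : ∀ x ∈ closure Ω, chartOf Ω x.rep ≠ 0)
  (hK : ConeHyp (closure (coneSet (chartOf Ω) Ω)) (coneSet (chartOf Ω) Ω) (chartOf Ω) M)

include hf hK

theorem mem_face_of_eqv {x y : Fin d → ℝ} (hx0 : x ≠ 0) (hy0 : y ≠ 0)
    (hx : x ∈ closure (coneSet (chartOf Ω) Ω)) (hy : y ∈ closure (coneSet (chartOf Ω) Ω))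
    (he : Eqv (closure (coneSet (chartOf Ω) Ω)) x y) :
    Projectivization.mk ℝ y hy0 ∈ face Ω (Projectivization.mk ℝ x hx0) := by
  set f := chartOf Ω with hfdef
  have fx := hK.fpos x hx hx0
  have fy := hK.fpos y hy hy0
  -- normalise
  have hX := Eqv.smul' hK (inv_pos.2 fx) hx
  have hY := Eqv.smul' hK (inv_pos.2 fy) hy
  set X := (f x)⁻¹ • x with hXd
  set Y := (f y)⁻¹ • y with hYd
  have fX : f X = 1 := by simp [X, fx.ne']
  have fY : f Y = 1 := by simp [Y, fy.ne']
  have XK : X ∈ closure (coneSet f Ω) := hK.smul _ (inv_pos.2 fx).le _ hx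
  have YK : Y ∈ closure (coneSet f Ω) := hK.smul _ (inv_pos.2 fy).le _ hy
  obtain ⟨⟨a, ha, haK⟩, ⟨b, hb, hbK⟩⟩ := Eqv.trans' hK hX (Eqv.trans' hK he (Eqv.symm' hK hY))
  obtain ⟨ε, hε, hε1, hεa, hεb⟩ : ∃ ε : ℝ, 0 < ε ∧ ε < 1 ∧ ε ≤ a ∧ ε ≤ b :=
    ⟨min (1 / 2) (min a b), by positivity, by
      have := min_le_left (1 / 2 : ℝ) (min a b); linarith,
      (min_le_right _ _).trans (min_le_left _ _), (min_le_right _ _).trans (min_le_right _ _)⟩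
  have k1 : Y - ε • X ∈ closure (coneSet f Ω) := by
    have := hK.add _ haK _ (hK.smul (a - ε) (by linarith) _ XK)
    convert this using 1; module
  have k2 : X - ε • Y ∈ closure (coneSet f Ω) := by
    have := hK.add _ hbK _ (hK.smul (b - ε) (by linarith) _ YK)
    convert this using 1; module
  have h1ε : 0 < 1 - ε := by linarith
  have mkp : ∀ z ∈ closure (coneSet f Ω), f z = 1 - ε → ∃ q ∈ closure Ω,
      cmap Ω q = (1 - ε)⁻¹ • z := by
    intro z hz hfz
    have z0 : z ≠ 0 := by rintro rfl; rw [map_zero] at hfz; linarith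
    refine ⟨_, mk_mem_closure z0 hz, ?_⟩
    unfold cmap
    rw [chartMap_mk, ← hfdef, hfz]
  obtain ⟨q1, hq1, e1⟩ := mkp _ k2 (by simp [fX, fY])
  obtain ⟨q2, hq2, e2⟩ := mkp _ k1 (by simp [fX, fY])
  right
  refine ⟨mk_mem_closure hy0 hy, q1, hq1, q2, hq2, ⟨mk_mem_closure hx0 hx, ?_⟩,
    ⟨mk_mem_closure hy0 hy, ?_⟩⟩
  · rw [e1, e2]
    unfold cmap
    rw [chartMap_mk, ← hfdef, ← hXd]
    refine ⟨1 / (1 + ε), ε / (1 + ε), by positivity, by positivity, by field_simp, ?_⟩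
    have : X = (1 / (1 + ε) * (1 - ε)⁻¹ * (1 - ε * ε)) • X := by
      have : 1 / (1 + ε) * (1 - ε)⁻¹ * (1 - ε * ε) = 1 := by
        field_simp; ring
      rw [this, one_smul]
    conv_rhs => rw [this]
    module
  · rw [e1, e2]
    unfold cmap
    rw [chartMap_mk, ← hfdef, ← hYd]
    refine ⟨ε / (1 + ε), 1 / (1 + ε), by positivity, by positivity, by field_simp; ring, ?_⟩
    have : Y = (1 / (1 + ε) * (1 - ε)⁻¹ * (1 - ε * ε)) • Y := by
      have : 1 / (1 + ε) * (1 - ε)⁻¹ * (1 - ε * ε) = 1 := by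
        field_simp; ring
      rw [this, one_smul]
    conv_rhs => rw [this]
    module

theorem le_of_openSegment {a b x y : Fin d → ℝ} (ha : a ∈ closure (coneSet (chartOf Ω) Ω))
    (hb : b ∈ closure (coneSet (chartOf Ω) Ω)) (hx : x ∈ openSegment ℝ a b)
    (hy : y ∈ openSegment ℝ a b) : Le (closure (coneSet (chartOf Ω) Ω)) x y := by
  obtain ⟨s, t, hs, ht, hst, rfl⟩ := hx
  obtain ⟨s', t', hs', ht', hst', rfl⟩ := hy
  have l1 := Le.add_right hK (Le.smul_right hK hs' (Le.refl' hK ha)) (hK.smul _ ht'.le _ hb)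
  have l2 := Le.add_left hK (Le.smul_right hK ht' (Le.refl' hK hb)) (hK.smul _ hs'.le _ ha)
  exact Le.add_le hK (Le.smul_left hK hs l1) (Le.smul_left hK ht l2)

theorem eqv_of_mem_face {x y : Fin d → ℝ} (hx0 : x ≠ 0) (hy0 : y ≠ 0)
    (hx : x ∈ closure (coneSet (chartOf Ω) Ω)) (hy : y ∈ closure (coneSet (chartOf Ω) Ω))
    (hm : Projectivization.mk ℝ y hy0 ∈ face Ω (Projectivization.mk ℝ x hx0)) :
    Eqv (closure (coneSet (chartOf Ω) Ω)) x y := by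
  have fx := hK.fpos x hx hx0
  have fy := hK.fpos y hy hy0
  have hX := Eqv.smul' hK (inv_pos.2 fx) hx
  have hY := Eqv.smul' hK (inv_pos.2 fy) hy
  refine Eqv.trans' hK (Eqv.symm' hK hX) (Eqv.trans' hK ?_ hY)
  have XK := hK.smul _ (inv_pos.2 fx).le _ hx
  rcases hm with h | ⟨-, a, ha, b, hb, ⟨-, h1⟩, ⟨-, h2⟩⟩
  · have := congrArg (chartMap (chartOf Ω)) h
    rw [chartMap_mk, chartMap_mk] at this
    rw [this]
    exact ⟨Le.refl' hK XK, Le.refl' hK XK⟩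
  · unfold cmap at h1 h2
    rw [chartMap_mk] at h1 h2
    have lift : ∀ q ∈ closure Ω, chartMap (chartOf Ω) q ∈ closure (coneSet (chartOf Ω) Ω) := by
      intro q hq
      obtain ⟨h0, h1, h2⟩ := exists_lift hf hq
      exact mem_closure_coneSet h0 (by rw [h1]; exact one_pos) (by rw [h2]; exact hq)
    exact ⟨le_of_openSegment hf hK (lift a ha) (lift b hb) h1 h2,
      le_of_openSegment hf hK (lift a ha) (lift b hb) h2 h1⟩

end

theorem hilb_chart {O' : Set (Fin d → ℝ)} {u w : Fin d → ℝ} {R : ℝ} (huw : u ≠ w)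
    (hba : BddAbove {t : ℝ | u + t • (w - u) ∈ O'}) (hbb : BddBelow {t : ℝ | u + t • (w - u) ∈ O'})
    {t₁ t₂ : ℝ} (h1 : t₁ ∈ {t : ℝ | u + t • (w - u) ∈ O'}) (h1' : t₁ < 0)
    (h2 : t₂ ∈ {t : ℝ | u + t • (w - u) ∈ O'}) (h2' : 1 < t₂)
    (hd : hilbertDistChart O' u w < R) :
    (∃ t ∈ {t : ℝ | u + t • (w - u) ∈ O'}, t < - (1 / Real.exp (2 * R))) ∧
    ∃ t ∈ {t : ℝ | u + t • (w - u) ∈ O'}, 1 + 1 / Real.exp (2 * R) < t := by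
  unfold hilbertDistChart at hd
  rw [if_neg huw] at hd
  set T := {t : ℝ | u + t • (w - u) ∈ O'} with hT
  have htm : sInf T < 0 := (csInf_le hbb h1).trans_lt h1'
  have htp : 1 < sSup T := h2'.trans_le (le_csSup hba h2)
  set tm := sInf T
  set tp := sSup T
  have hpos : 0 < (tp * (1 - tm)) / ((-tm) * (tp - 1)) := by
    apply div_pos <;> apply mul_pos <;> linarith
  have hlog : Real.log ((tp * (1 - tm)) / ((-tm) * (tp - 1))) < 2 * R := by linarith
  rw [Real.log_lt_iff_lt_exp hpos] at hlog
  have hden : 0 < (-tm) * (tp - 1) := by apply mul_pos <;> linarith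
  rw [div_lt_iff₀ hden] at hlog
  set E := Real.exp (2 * R)
  have hE : 0 < E := Real.exp_pos _
  constructor
  · apply exists_lt_of_csInf_lt ⟨_, h1⟩
    have : 1 < E * (-tm) := by
      have h3 : (tp - 1) * (1 - tm) < (tp - 1) * (E * (-tm)) := by nlinarith
      have := lt_of_mul_lt_mul_left h3 (by linarith)
      linarith
    rw [lt_neg, div_lt_iff₀ hE]
    linarith
  · apply exists_lt_of_lt_csSup ⟨_, h1⟩
    have : tp < E * (tp - 1) := by
      have h3 : (-tm) * tp < (-tm) * (E * (tp - 1)) := by nlinarith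
      exact lt_of_mul_lt_mul_left h3 (by linarith)
    have h4 : 1 / E < tp - 1 := by
      rw [div_lt_iff₀ hE]; linarith
    linarith

theorem line_ends {B : Set (Fin d → ℝ)} (hB : Convex ℝ B) {b0 v : Fin d → ℝ}
    (hl : ∀ b ∈ B, ∃ c : ℝ, b = b0 + c • v) :
    ∃ e₁ e₂ : Fin d → ℝ, ∀ z ∈ closure B, z ∉ B → z = e₁ ∨ z = e₂ := by
  by_cases hv : v = 0
  · refine ⟨b0, b0, fun z hz hzB => ?_⟩
    have : B ⊆ {b0} := by
      intro b hb
      obtain ⟨c, hc⟩ := hl b hb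
      simp [hc, hv]
    have := closure_minimal this isClosed_singleton hz
    exact Or.inl this
  let γ : ℝ → Fin d → ℝ := fun s => b0 + s • v
  have hγ : Topology.IsClosedEmbedding γ :=
    (Homeomorph.addLeft b0).isClosedEmbedding.comp (isClosedEmbedding_smul_left hv)
  let I : Set ℝ := {s | γ s ∈ B}
  have hBI : B = γ '' I := by
    ext b
    constructor
    · intro hb
      obtain ⟨c, hc⟩ := hl b hb
      exact ⟨c, by simp only [I, mem_setOf_eq, γ]; rw [← hc]; exact hb, hc.symm⟩
    · rintro ⟨s, hs, rfl⟩; exact hs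
  have hI : Convex ℝ I := by
    intro s hs t ht a b ha hb hab
    have := hB hs ht ha hb hab
    simp only [I, mem_setOf_eq]
    convert this using 1
    simp only [γ, smul_eq_mul]
    have : b0 = (a + b) • b0 := by rw [hab, one_smul]
    conv_lhs => rw [this]
    module
  refine ⟨γ (sInf I), γ (sSup I), fun z hz hzB => ?_⟩
  rw [hBI, hγ.closure_image_eq] at hz
  obtain ⟨s, hs, rfl⟩ := hz
  have hsI : s ∉ I := hzB
  have hoc := hI.ordConnected
  have hne : I.Nonempty := by
    rw [← closure_nonempty_iff]; exact ⟨s, hs⟩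
  obtain ⟨r, hr⟩ := hne
  have hrs : r ≠ s := fun h => hsI (h ▸ hr)
  rcases lt_or_gt_of_ne hrs with h | h
  · right
    have hub : s ∈ upperBounds I := by
      intro t ht
      by_contra hlt
      exact hsI (hoc.out hr ht ⟨h.le, (not_le.1 hlt).le⟩)
    have : IsLUB I s := isLUB_of_mem_closure hub hs
    rw [this.csSup_eq ⟨r, hr⟩]
  · left
    have hub : s ∈ lowerBounds I := by
      intro t ht
      by_contra hlt
      exact hsI (hoc.out ht hr ⟨(not_le.1 hlt).le, h.le⟩)
    have : IsGLB I s := isGLB_of_mem_closure hub hs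
    rw [this.csInf_eq ⟨r, hr⟩]

section
variable {Ω : Set (PSpace d)} {M : ℝ}
  (hf : ∀ x ∈ closure Ω, chartOf Ω x.rep ≠ 0)
  (hK : ConeHyp (closure (coneSet (chartOf Ω) Ω)) (coneSet (chartOf Ω) Ω) (chartOf Ω) M)

include hf hK

theorem face_sub {q : PSpace d} (hq : q ∈ closure Ω) : face Ω q ⊆ closure Ω := by
  rintro p (rfl | ⟨h, -⟩)
  · exact hq
  · exact h

theorem exists_lift' {q : PSpace d} (hq : q ∈ closure Ω) :
    ∃ y ∈ closure (coneSet (chartOf Ω) Ω), ∃ h : y ≠ 0, q = Projectivization.mk ℝ y h := by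
  obtain ⟨h0, h1, h2⟩ := exists_lift hf hq
  exact ⟨_, mem_closure_coneSet h0 (by rw [h1]; exact one_pos) (by rw [h2]; exact hq), h0, h2.symm⟩

theorem face_chart {x : Fin d → ℝ} (hx0 : x ≠ 0) (hx : x ∈ closure (coneSet (chartOf Ω) Ω))
    {g : (Fin d → ℝ) →ₗ[ℝ] ℝ} {σ : ℝ} (hσ : σ * σ = 1)
    (hg : ∀ y ∈ closure (coneSet (chartOf Ω) Ω), y ≠ 0 →
      Le (closure (coneSet (chartOf Ω) Ω)) y x → 0 < σ * g y) (u : Fin d → ℝ) :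
    u ∈ chartMap g '' (face Ω (Projectivization.mk ℝ x hx0)) ↔
      g u = 1 ∧ σ • u ∈ closure (coneSet (chartOf Ω) Ω) ∧
        Eqv (closure (coneSet (chartOf Ω) Ω)) x (σ • u) := by
  have hσ0 : σ ≠ 0 := by rintro rfl; simp at hσ
  constructor
  · rintro ⟨q, hq, rfl⟩
    obtain ⟨y, hy, hy0, rfl⟩ := exists_lift' hf hK (face_sub hf hK (mk_mem_closure hx0 hx) hq)
    have he := eqv_of_mem_face hf hK hx0 hy0 hx hy hq
    have hp := hg y hy hy0 he.2
    have hgy : g y ≠ 0 := by intro h; rw [h] at hp; simp at hp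
    rw [chartMap_mk]
    have e : σ • (g y)⁻¹ • y = (σ * g y)⁻¹ • y := by
      rw [smul_smul]
      congr 1
      rw [mul_inv]
      congr 1
      exact (inv_eq_of_mul_eq_one_left hσ).symm
    rw [e]
    exact ⟨by simp [hgy], hK.smul _ (inv_pos.2 hp).le _ hy,
      Eqv.trans' hK he (Eqv.symm' hK (Eqv.smul' hK (inv_pos.2 hp) hy))⟩
  · rintro ⟨h1, h2, h3⟩
    have hu0 : u ≠ 0 := by rintro rfl; simp at h1
    have hy0 : σ • u ≠ 0 := smul_ne_zero hσ0 hu0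
    refine ⟨Projectivization.mk ℝ (σ • u) hy0, mem_face_of_eqv hf hK hx0 hy0 hx h2 h3, ?_⟩
    rw [chartMap_mk, map_smul, h1, smul_eq_mul, mul_one, smul_smul, inv_mul_cancel₀ hσ0, one_smul]

theorem face_pc {x : Fin d → ℝ} (hx0 : x ≠ 0) (hx : x ∈ closure (coneSet (chartOf Ω) Ω)) :
    IsProperlyConvex (face Ω (Projectivization.mk ℝ x hx0)) := by
  have hG := face_chart hf hK hx0 hx (g := chartOf Ω) (σ := 1) (by norm_num)
    (fun y hy h0 _ => by simpa using hK.fpos y hy h0)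
  simp only [one_smul] at hG
  refine ⟨chartOf Ω, fun q hq => hf q ?_, ?_, ?_⟩
  · exact closure_minimal (face_sub hf hK (mk_mem_closure hx0 hx)) isClosed_closure hq
  · intro u hu w hw a b ha hb hab
    rw [hG] at hu hw ⊢
    refine ⟨by simp [hu.1, hw.1, hab], hK.add _ (hK.smul _ ha _ hu.2.1) _ (hK.smul _ hb _ hw.2.1), ?_⟩
    rcases ha.eq_or_lt with rfl | ha
    · have : b = 1 := by linarith
      subst this
      simpa using hw.2.2
    constructor
    · exact Le.add_right hK (Le.smul_right hK ha hu.2.2.1) (hK.smul _ hb _ hw.2.1)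
    · rcases hb.eq_or_lt with rfl | hb
      · have : a = 1 := by linarith
        subst this
        simpa using hu.2.2.2
      · exact Le.add_le hK (Le.smul_left hK ha hu.2.2.2) (Le.smul_left hK hb hw.2.2.2)
  · rw [isBounded_iff_forall_norm_le]
    refine ⟨M, fun u hu => ?_⟩
    rw [hG] at hu
    have := hK.bound u hu.2.1
    rwa [hu.1, mul_one] at this

theorem face_sign {x : Fin d → ℝ} (hx0 : x ≠ 0) (hx : x ∈ closure (coneSet (chartOf Ω) Ω))
    {g : (Fin d → ℝ) →ₗ[ℝ] ℝ}
    (hg : ∀ q ∈ closure (face Ω (Projectivization.mk ℝ x hx0)), g q.rep ≠ 0) :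
    ∃ σ : ℝ, σ * σ = 1 ∧ ∀ y ∈ closure (coneSet (chartOf Ω) Ω), y ≠ 0 →
      Le (closure (coneSet (chartOf Ω) Ω)) y x → 0 < σ * g y := by
  have nv : ∀ y ∈ closure (coneSet (chartOf Ω) Ω), y ≠ 0 →
      Le (closure (coneSet (chartOf Ω) Ω)) y x → g y ≠ 0 := by
    intro y hy hy0 hl
    rw [← rep_ne_iff g hy0]
    apply hg
    rw [mem_closure_iff]
    intro U hU hyU
    have hc : ContinuousAt (fun t : ℝ => y + t • x) 0 := by fun_prop
    have hm : {v : Fin d → ℝ | ∃ h : v ≠ 0, Projectivization.mk ℝ v h ∈ U} ∈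
        nhds (y + (0 : ℝ) • x) := by
      rw [zero_smul, add_zero]
      exact (isOpen_lift hU).mem_nhds ⟨hy0, hyU⟩
    obtain ⟨ε, hε, hb⟩ := Metric.mem_nhds_iff.1 (hc.preimage_mem_nhds hm)
    have hmem : ε / 2 ∈ Metric.ball (0 : ℝ) ε := by
      rw [Metric.mem_ball, Real.dist_eq, sub_zero, abs_of_pos (by positivity)]
      linarith
    obtain ⟨h0, hU'⟩ := hb hmem
    refine ⟨_, hU', mem_face_of_eqv hf hK hx0 h0 hx ?_ ⟨?_, ?_⟩⟩
    · exact hK.add _ hy _ (hK.smul _ (by positivity) _ hx)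
    · exact Le.add_left hK (Le.smul_right hK (by positivity) (Le.refl' hK hx)) hy
    · exact Le.add_le hK hl (Le.smul_left hK (by positivity) (Le.refl' hK hx))
  have hgx := nv x hx hx0 (Le.refl' hK hx)
  have main : ∀ y ∈ closure (coneSet (chartOf Ω) Ω), y ≠ 0 →
      Le (closure (coneSet (chartOf Ω) Ω)) y x → 0 < g x * g y := by
    intro y hy hy0 hl
    by_contra hneg
    have hgy := nv y hy hy0 hl
    have hlt : g x * g y < 0 := lt_of_le_of_ne (not_lt.1 hneg) (mul_ne_zero hgx hgy)
    have hc : 0 < - g y / g x := by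
      have : - g y / g x = - (g x * g y) / (g x * g x) := by field_simp
      rw [this]
      apply div_pos (by linarith)
      exact mul_self_pos.2 hgx
    have h0 : y + (- g y / g x) • x ≠ 0 := by
      intro h0
      have h1 := hK.fpos y hy hy0
      have h2 := hK.fpos x hx hx0
      have := congrArg (chartOf Ω) h0
      rw [map_add, map_smul, map_zero, smul_eq_mul] at this
      have := mul_pos hc h2
      linarith
    apply nv _ (hK.add _ hy _ (hK.smul _ hc.le _ hx)) h0
      (Le.add_le hK hl (Le.smul_left hK hc (Le.refl' hK hx)))
    rw [map_add, map_smul, smul_eq_mul]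
    field_simp
    ring
  rcases lt_or_gt_of_ne hgx with h | h
  · refine ⟨-1, by norm_num, fun y hy h0 hl => ?_⟩
    have := main y hy h0 hl
    nlinarith
  · refine ⟨1, by norm_num, fun y hy h0 hl => ?_⟩
    have := main y hy h0 hl
    nlinarith

/-- points at bounded Hilbert distance in a face -/
theorem face_hilb {x : Fin d → ℝ} (hx0 : x ≠ 0) (hx : x ∈ closure (coneSet (chartOf Ω) Ω))
    {g : (Fin d → ℝ) →ₗ[ℝ] ℝ} {σ : ℝ} (hσ : σ * σ = 1)
    (hg : ∀ y ∈ closure (coneSet (chartOf Ω) Ω), y ≠ 0 →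
      Le (closure (coneSet (chartOf Ω) Ω)) y x → 0 < σ * g y)
    (hbd : Bornology.IsBounded (chartMap g '' (face Ω (Projectivization.mk ℝ x hx0)))) (R : ℝ) :
    ∃ ε : ℝ, 0 < ε ∧ ∀ u ∈ chartMap g '' (face Ω (Projectivization.mk ℝ x hx0)),
      ∀ w ∈ chartMap g '' (face Ω (Projectivization.mk ℝ x hx0)),
      hilbertDistChart (chartMap g '' (face Ω (Projectivization.mk ℝ x hx0))) u w < R →
      σ • u - ε • σ • w ∈ closure (coneSet (chartOf Ω) Ω) ∧
      σ • w - ε • σ • u ∈ closure (coneSet (chartOf Ω) Ω) := by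
  have hG := face_chart hf hK hx0 hx hσ hg
  set O' := chartMap g '' (face Ω (Projectivization.mk ℝ x hx0)) with hO'
  set K := closure (coneSet (chartOf Ω) Ω) with hKd
  set ρ := 1 / Real.exp (2 * R) with hρ
  have hρ0 : 0 < ρ := by positivity
  refine ⟨ρ / (1 + ρ), by positivity, fun u hu w hw hd => ?_⟩
  have hε1 : ρ / (1 + ρ) < 1 := by rw [div_lt_one (by positivity)]; linarith
  obtain ⟨gu, uK, ue⟩ := (hG u).1 hu
  obtain ⟨gw, wK, we⟩ := (hG w).1 hw
  by_cases huw : u = w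
  · subst huw
    have := hK.smul (1 - ρ / (1 + ρ)) (by linarith) _ uK
    rw [sub_smul, one_smul] at this
    exact ⟨this, this⟩
  -- extension
  have ext : ∀ {u w : Fin d → ℝ}, g u = 1 → g w = 1 → σ • u ∈ K → σ • w ∈ K →
      Eqv K x (σ • u) → Eqv K x (σ • w) → ∃ δ : ℝ, 0 < δ ∧ w + δ • (w - u) ∈ O' := by
    intro u w gu gw uK wK ue we
    obtain ⟨a, ha, haK⟩ := Le.trans' hK ue.2 we.1
    -- w - a u ∈ K
    refine ⟨a / 2 , by positivity, ?_⟩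
    rw [hG]
    have e : σ • (w + (a / 2) • (w - u)) =
        (1 / 2 : ℝ) • (σ • w - a • σ • u) + ((1 + a) / 2) • σ • w := by module
    have m1 := hK.smul (1 / 2 : ℝ) (by norm_num) _ haK
    have m2 := hK.smul ((1 + a) / 2) (by positivity) _ wK
    refine ⟨by simp [gu, gw], ?_, ?_, ?_⟩
    · rw [e]; exact hK.add _ m1 _ m2
    · rw [e]; exact Le.add_left hK (Le.smul_right hK (by positivity) we.1) m1
    · refine Le.trans' hK (Le.of_sub hK (y := (1 + a / 2) • σ • w) ?_)
        (Le.smul_left hK (by positivity) we.2)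
      have := hK.smul (a / 2) (by positivity) _ uK
      convert this using 1
      module
  obtain ⟨δ₂, hδ₂, h2⟩ := ext gu gw uK wK ue we
  obtain ⟨δ₁, hδ₁, h1⟩ := ext gw gu wK uK we ue
  obtain ⟨N, hN⟩ := isBounded_iff_forall_norm_le.1 hbd
  have hn : 0 < ‖w - u‖ := norm_pos_iff.2 (sub_ne_zero.2 (Ne.symm huw))
  have habs : ∀ t ∈ {t : ℝ | u + t • (w - u) ∈ O'}, |t| ≤ (N + ‖u‖) / ‖w - u‖ := by
    intro t ht
    rw [le_div_iff₀ hn, ← Real.norm_eq_abs, ← norm_smul]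
    have h3 := hN _ ht
    have : t • (w - u) = (u + t • (w - u)) - u := by abel
    rw [this]
    exact (norm_sub_le _ _).trans (by linarith)
  have hcomb : ∀ t ∈ {t : ℝ | u + t • (w - u) ∈ O'}, σ • (u + t • (w - u)) ∈ K := fun t ht =>
    ((hG _).1 ht).2.1
  obtain ⟨⟨s, hs, hs'⟩, ⟨t, ht, ht'⟩⟩ := hilb_chart (R := R) huw
    ⟨_, fun t ht => (le_abs_self t).trans (habs t ht)⟩
    ⟨-((N + ‖u‖) / ‖w - u‖), fun t ht => by linarith [neg_abs_le t, habs t ht]⟩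
    (t₁ := -δ₁) (t₂ := 1 + δ₂)
    (by
      simp only [mem_setOf_eq]
      convert h1 using 1
      module) (by linarith)
    (by
      simp only [mem_setOf_eq]
      convert h2 using 1
      module) (by linarith) hd
  rw [← hρ] at hs' ht'
  have fin : ∀ {u w : Fin d → ℝ}, σ • w ∈ K → ∀ r : ℝ, ρ < r → σ • (u + (-r) • (w - u)) ∈ K →
      σ • u - (ρ / (1 + ρ)) • σ • w ∈ K := by
    intro u w wK r hr hm
    have hr0 : 0 < r := hρ0.trans hr
    have hle : ρ / (1 + ρ) ≤ r / (1 + r) := by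
      rw [div_le_div_iff₀ (by positivity) (by positivity)]; nlinarith
    have := hK.add _ (hK.smul (1 / (1 + r)) (by positivity) _ hm) _
      (hK.smul (r / (1 + r) - ρ / (1 + ρ)) (by linarith) _ wK)
    convert this using 1
    have e1 : u = ((1 + r) / (1 + r)) • u := by rw [div_self (by positivity), one_smul]
    conv_lhs => rw [e1]
    module
  constructor
  · exact fin wK (-s) (by linarith) (by simpa using hcomb s hs)
  · refine fin uK (t - 1) (by linarith) ?_
    have := hcomb t ht
    convert this using 1
    module

end

theorem fieldH {Ω C : Set (PSpace d)} {M : ℝ}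
    (hf : ∀ x ∈ closure Ω, chartOf Ω x.rep ≠ 0)
    (hK : ConeHyp (closure (coneSet (chartOf Ω) Ω)) (coneSet (chartOf Ω) Ω) (chartOf Ω) M)
    (hCΩ : C ⊆ Ω) (hne : C.Nonempty) (hcv : Convex ℝ (cmap Ω '' C))
    (hcdim : ∀ x ∈ idealBdry C, cdim (face Ω x) (idealBdry C ∩ face Ω x) ≤ 1)
    (x : Fin d → ℝ) (hxQ : x ∈ closure (coneSet (chartOf Ω) C)) (hx0 : x ≠ 0)
    (hxO : x ∉ coneSet (chartOf Ω) Ω) :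
    ∃ (φ : (Fin d → ℝ) →ₗ[ℝ] ℝ) (ε : ℝ) (e₁ e₂ : Fin d → ℝ), 0 < ε ∧
    (∀ y ∈ closure (coneSet (chartOf Ω) Ω), y ≠ 0 → Le (closure (coneSet (chartOf Ω) Ω)) y x → 0 < φ y) ∧
    ∀ y ∈ closure (coneSet (chartOf Ω) C), Le (closure (coneSet (chartOf Ω) Ω)) y x →
      ¬ Le (closure (coneSet (chartOf Ω) Ω)) x y → φ y = 1 →
      (y - ε • e₁ ∈ closure (coneSet (chartOf Ω) Ω) ∧ e₁ - ε • y ∈ closure (coneSet (chartOf Ω) Ω)) ∨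
      (y - ε • e₂ ∈ closure (coneSet (chartOf Ω) Ω) ∧ e₂ - ε • y ∈ closure (coneSet (chartOf Ω) Ω)) := by
  have hsub : coneSet (chartOf Ω) C ⊆ coneSet (chartOf Ω) Ω := fun v hv =>
    ⟨hv.1, hv.2.1, hCΩ hv.2.2⟩
  have hQK : closure (coneSet (chartOf Ω) C) ⊆ closure (coneSet (chartOf Ω) Ω) := closure_mono hsub
  have hQne : (coneSet (chartOf Ω) C).Nonempty :=
    coneSet_nonempty hne fun x hx => hf x (subset_closure (hCΩ hx))
  have hxK := hQK hxQ
  -- lifts in Q not in O are in ideal boundary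
  have hib : ∀ y (hy : y ≠ 0), y ∈ closure (coneSet (chartOf Ω) C) → y ∉ coneSet (chartOf Ω) Ω →
      Projectivization.mk ℝ y hy ∈ idealBdry C := by
    intro y hy hyQ hyO
    refine ⟨mk_mem_closure hy hyQ, fun hC => hyO ⟨hK.fpos y (hQK hyQ) hy, hy, hCΩ hC⟩⟩
  set q := Projectivization.mk ℝ x hx0 with hq
  have hG : IsProperlyConvex (face Ω q) := face_pc hf hK hx0 hxK
  obtain ⟨hg1, hg2, hg3⟩ := chartOf_spec hG
  set g := chartOf (face Ω q) with hg
  obtain ⟨σ, hσ, hσg⟩ := face_sign hf hK hx0 hxK hg1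
  have hchart := face_chart hf hK hx0 hxK hσ hσg
  have hcd := hcdim q (hib x hx0 hxQ hxO)
  -- set nonempty
  have hSne : {k : ℕ | ∃ R : ℝ, 0 < R ∧ ∃ B : Set (PSpace d), B ⊆ face Ω q ∧
    Convex ℝ (cmap (face Ω q) '' B) ∧ pdimIn (face Ω q) B = k ∧
    idealBdry C ∩ face Ω q ⊆ {p ∈ face Ω q | ∃ q' ∈ B, hilbertDist (face Ω q) p q' < R}}.Nonempty :=
    ⟨_, 1, one_pos, face Ω q, subset_rfl, hg2, rfl, fun p hp => ⟨hp.2, p, hp.2, by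
      simp [hilbertDist, hilbertDistChart]⟩⟩
  obtain ⟨R, hR, B, hBG, hBc, hBd, hBA⟩ := Nat.sInf_mem hSne
  change pdimIn (face Ω q) B = cdim (face Ω q) (idealBdry C ∩ face Ω q) at hBd
  rw [← hBd] at hcd
  obtain ⟨ε, hε, hhil⟩ := face_hilb hf hK hx0 hxK hσ hσg hg3 R
  set B' := chartMap g '' B with hB'
  have hB'c : Convex ℝ B' := hBc
  have hB'sub : B' ⊆ chartMap g '' face Ω q := image_mono hBG
  -- line
  have hline : ∃ b0 v : Fin d → ℝ, ∀ b ∈ B', ∃ c : ℝ, b = b0 + c • v := by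
    obtain ⟨-, q', hq', -⟩ := hBA ⟨hib x hx0 hxQ hxO, mem_insert _ _⟩
    obtain ⟨⟨v, hvm⟩, hv⟩ := finrank_le_one_iff.1 hcd
    refine ⟨chartMap g q', v, fun b hb => ?_⟩
    have hm : b -ᵥ chartMap g q' ∈ (affineSpan ℝ B').direction :=
      AffineSubspace.vsub_mem_direction (mem_affineSpan ℝ hb)
        (mem_affineSpan ℝ (mem_image_of_mem _ hq'))
    obtain ⟨c, hc⟩ := hv ⟨_, hm⟩
    have := congrArg Subtype.val hc
    simp only [vsub_eq_sub, SetLike.val_smul] at this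
    exact ⟨c, by rw [this]; abel⟩
  obtain ⟨b0, v, hl⟩ := hline
  obtain ⟨e₁, e₂, hends⟩ := line_ends hB'c hl
  have hσ0 : σ ≠ 0 := by rintro rfl; simp at hσ
  refine ⟨σ • g, ε, σ • e₁, σ • e₂, hε, fun y hy hy0 hl => by simpa using hσg y hy hy0 hl, ?_⟩
  intro y hyQ hyx hxy hφ
  have hφ' : σ * g y = 1 := by simpa using hφ
  have hyK := hQK hyQ
  let t : ℕ → ℝ := fun n => 1 / ((n : ℝ) + 1)
  have tpos : ∀ n, 0 < t n := fun n => by positivity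
  have t0 : Tendsto t atTop (nhds 0) := tendsto_one_div_add_atTop_nhds_zero_nat
  let p : ℕ → (Fin d → ℝ) := fun n => y + t n • x
  have pQ : ∀ n, p n ∈ closure (coneSet (chartOf Ω) C) := fun n =>
    closure_add hcv hyQ (closure_smul hQne (tpos n).le hxQ)
  have plx : ∀ n, Le (closure (coneSet (chartOf Ω) Ω)) (p n) x := fun n =>
    Le.add_le hK hyx (Le.smul_left hK (tpos n) (Le.refl' hK hxK))
  have pxl : ∀ n, Le (closure (coneSet (chartOf Ω) Ω)) x (p n) := fun n =>
    Le.add_left hK (Le.smul_right hK (tpos n) (Le.refl' hK hxK)) hyK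
  have pO : ∀ n, p n ∉ coneSet (chartOf Ω) Ω := fun n hn => hxO (Le.mem_O hK hn (plx n))
  have gx := hσg x hxK hx0 (Le.refl' hK hxK)
  have gp : ∀ n, 0 < σ * g (p n) := fun n => by
    have : σ * g (p n) = 1 + t n * (σ * g x) := by
      simp only [p, map_add, map_smul, smul_eq_mul]; rw [← hφ']; ring
    rw [this]; have := mul_pos (tpos n) gx; linarith
  have p0 : ∀ n, p n ≠ 0 := fun n h => by have := gp n; rw [h] at this; simp at this
  have pf : ∀ n, Projectivization.mk ℝ (p n) (p0 n) ∈ face Ω q := fun n =>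
    mem_face_of_eqv hf hK hx0 (p0 n) hxK (hQK (pQ n)) ⟨pxl n, plx n⟩
  have hnear : ∀ n, ∃ w ∈ B', σ • chartMap g (Projectivization.mk ℝ (p n) (p0 n)) - ε • σ • w ∈
      closure (coneSet (chartOf Ω) Ω) ∧ σ • w - ε • σ • chartMap g (Projectivization.mk ℝ (p n) (p0 n)) ∈
      closure (coneSet (chartOf Ω) Ω) := by
    intro n
    obtain ⟨-, q', hq', hd⟩ := hBA ⟨hib _ (p0 n) (pQ n) (pO n), pf n⟩
    exact ⟨_, mem_image_of_mem _ hq', hhil _ (mem_image_of_mem _ (pf n)) _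
      (hB'sub (mem_image_of_mem _ hq')) hd⟩
  choose w hwB hw1 hw2 using hnear
  obtain ⟨z, hz, κ, hκ, hlim⟩ := tendsto_subseq_of_bounded (hg3.subset hB'sub) hwB
  have pt : Tendsto p atTop (nhds y) := by
    have := (t0.smul_const x).const_add y
    simpa using this
  have lim1 : Tendsto (fun n => σ • chartMap g (Projectivization.mk ℝ (p n) (p0 n))) atTop (nhds y) := by
    have gy0 : g y ≠ 0 := by intro h; rw [h] at hφ'; simp at hφ'
    have h1 : Tendsto (fun n => g (p n)) atTop (nhds (g y)) := ((lin_cont g).tendsto y).comp pt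
    have h2 := (((h1.inv₀ gy0).smul pt).const_smul σ)
    have e : σ • (g y)⁻¹ • y = y := by
      rw [smul_smul]
      have : σ * (g y)⁻¹ = 1 := by
        field_simp
        have : σ * (σ * g y) = σ := by rw [hφ', mul_one]
        rw [← this, ← mul_assoc, hσ, one_mul]
      rw [this, one_smul]
    rw [e] at h2
    refine h2.congr fun n => ?_
    simp only [chartMap_mk]
  have lim1' := lim1.comp hκ.tendsto_atTop
  have m1 : y - ε • σ • z ∈ closure (coneSet (chartOf Ω) Ω) :=
    hK.closed.mem_of_tendsto (lim1'.sub ((hlim.const_smul σ).const_smul ε))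
      (Eventually.of_forall fun n => hw1 (κ n))
  have m2 : σ • z - ε • y ∈ closure (coneSet (chartOf Ω) Ω) :=
    hK.closed.mem_of_tendsto ((hlim.const_smul σ).sub (lim1'.const_smul ε))
      (Eventually.of_forall fun n => hw2 (κ n))
  have hzB : z ∉ B' := by
    intro hzB
    obtain ⟨-, -, hz3⟩ := (hchart z).1 (hB'sub hzB)
    exact hxy (Le.trans' hK hz3.1 ⟨ε, hε, m1⟩)
  rcases hends z hz hzB with rfl | rfl
  · exact Or.inl ⟨m1, m2⟩
  · exact Or.inr ⟨m1, m2⟩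

theorem pact_mk (g : (Fin d → ℝ) ≃ₗ[ℝ] (Fin d → ℝ)) {v : Fin d → ℝ} (hv : v ≠ 0) (hgv : g v ≠ 0) :
    pact g (Projectivization.mk ℝ v hv) = Projectivization.mk ℝ (g v) hgv := rfl

theorem pact_inj (g : (Fin d → ℝ) ≃ₗ[ℝ] (Fin d → ℝ)) : Function.Injective (pact g) :=
  Projectivization.map_injective _ _

theorem pact_closure {g : (Fin d → ℝ) ≃ₗ[ℝ] (Fin d → ℝ)} {A : Set (PSpace d)}
    (hA : pact g '' A ⊆ A) {v : Fin d → ℝ} (hv : v ≠ 0) (hgv : g v ≠ 0)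
    (hm : Projectivization.mk ℝ v hv ∈ closure A) : Projectivization.mk ℝ (g v) hgv ∈ closure A := by
  rw [mem_closure_iff] at hm ⊢
  intro U hU hvU
  have hgc : Continuous g := LinearMap.continuous_of_finiteDimensional g.toLinearMap
  have hN := (isOpen_lift hU).preimage hgc
  obtain ⟨q, ⟨u, ⟨h1, hu⟩, h0, rfl⟩, hqA⟩ := hm _ (isOpen_mk hN) ⟨v, ⟨hgv, hvU⟩, hv, rfl⟩
  exact ⟨_, hu, hA ⟨_, hqA, pact_mk g h0 h1⟩⟩

theorem chartMap_continuousAt (f : (Fin d → ℝ) →ₗ[ℝ] ℝ) {q : PSpace d} (hq : f q.rep ≠ 0) :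
    ContinuousAt (chartMap f) q := by
  intro V hV
  obtain ⟨V', hV', hVo, hqV⟩ := mem_nhds_iff.1 hV
  have hco : ContinuousOn (fun u : Fin d → ℝ => (f u)⁻¹ • u) {u | f u ≠ 0} :=
    ((lin_cont f).continuousOn.inv₀ fun u hu => hu).smul continuousOn_id
  have hN := hco.isOpen_inter_preimage (isOpen_ne_fun (lin_cont f) continuous_const) hVo
  rw [Filter.mem_map, mem_nhds_iff]
  refine ⟨_, ?_, isOpen_mk hN, q.rep, ⟨hq, hqV⟩, q.rep_nonzero, q.mk_rep.symm⟩
  rintro _ ⟨u, ⟨hu1, hu2⟩, h0, rfl⟩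
  rw [mem_preimage, chartMap_mk]
  exact hV' hu2

theorem isCompact_mk {N : Set (Fin d → ℝ)} (hN : IsCompact N) (h0 : (0 : Fin d → ℝ) ∉ N) :
    IsCompact {q : PSpace d | ∃ u ∈ N, ∃ h : u ≠ 0, q = Projectivization.mk ℝ u h} := by
  have hc : Continuous (fun v : {v : Fin d → ℝ // v ≠ 0} => (Projectivization.mk ℝ v.1 v.2 : PSpace d)) :=
    continuous_quotient_mk'
  have h1 : IsCompact {v : {v : Fin d → ℝ // v ≠ 0} | v.1 ∈ N} := by
    rw [Subtype.isCompact_iff]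
    convert hN using 1
    ext u
    constructor
    · rintro ⟨w, hw, rfl⟩; exact hw
    · exact fun h => ⟨⟨u, fun h' => h0 (h' ▸ h)⟩, h, rfl⟩
  convert h1.image hc using 1
  ext q
  constructor
  · rintro ⟨u, hu, h, rfl⟩
    exact ⟨⟨u, h⟩, hu, rfl⟩
  · rintro ⟨⟨u, h⟩, hu, rfl⟩
    exact ⟨u, hu, h, rfl⟩

theorem pres {Ω : Set (PSpace d)} {M : ℝ}
    (hf : ∀ x ∈ closure Ω, chartOf Ω x.rep ≠ 0)
    (hK : ConeHyp (closure (coneSet (chartOf Ω) Ω)) (coneSet (chartOf Ω) Ω) (chartOf Ω) M)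
    {g : (Fin d → ℝ) ≃ₗ[ℝ] (Fin d → ℝ)} (hgΩ : pact g '' Ω = Ω) {c : ℝ} {p : Fin d → ℝ}
    (hp : p ∈ coneSet (chartOf Ω) Ω) (hcp : 0 < chartOf Ω (c • g p)) :
    (∀ A ⊆ Ω, pact g '' A = A → A.Nonempty → ∀ x ∈ closure (coneSet (chartOf Ω) A),
      c • g x ∈ closure (coneSet (chartOf Ω) A)) ∧
    (∀ x ∈ closure (coneSet (chartOf Ω) Ω), x ∉ coneSet (chartOf Ω) Ω →
      c • g x ∉ coneSet (chartOf Ω) Ω) := by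
  set f := chartOf Ω with hfd
  have hc : c ≠ 0 := by rintro rfl; simp at hcp
  have hg0 : ∀ {x}, x ≠ 0 → g x ≠ 0 := fun h => by simpa using h
  have nv : ∀ x ∈ closure (coneSet f Ω), x ≠ 0 → f (g x) ≠ 0 := by
    intro x hx hx0
    rw [← rep_ne_iff f (hg0 hx0)]
    exact hf _ (pact_closure hgΩ.subset hx0 (hg0 hx0) (mk_mem_closure hx0 hx))
  have pos : ∀ x ∈ closure (coneSet f Ω), x ≠ 0 → 0 < f (c • g x) := by
    intro x hx hx0
    by_contra hneg
    have h1 : f (c • g x) ≠ 0 := by simpa using ⟨hc, nv x hx hx0⟩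
    have h2 : f (c • g x) < 0 := lt_of_le_of_ne (not_lt.1 hneg) h1
    set s := f (c • g p) / (- f (c • g x)) with hs
    have hs0 : 0 < s := div_pos hcp (by linarith)
    have hz := hK.add _ (hK.smul s hs0.le x hx) _ (hK.sub hp)
    have hfz : 0 < f (s • x + p) := by
      rw [map_add, map_smul, smul_eq_mul]
      have := mul_pos hs0 (hK.fpos x hx hx0)
      have := hp.1
      linarith
    have hz0 : s • x + p ≠ 0 := by intro h; rw [h, map_zero] at hfz; exact lt_irrefl _ hfz
    apply nv _ hz hz0
    have h3 : s * f (c • g x) + f (c • g p) = 0 := by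
      rw [hs]; field_simp; ring
    simp only [map_smul, smul_eq_mul] at h3
    have h4 : c * f (g (s • x + p)) = 0 := by
      simp only [map_add, map_smul, smul_eq_mul]; linear_combination h3
    exact (mul_eq_zero.1 h4).resolve_left hc
  have mkeq : ∀ x (hx : x ≠ 0), Projectivization.mk ℝ (c • g x) (smul_ne_zero hc (hg0 hx)) =
      Projectivization.mk ℝ (g x) (hg0 hx) := fun x hx => mk_smul _ hc
  constructor
  · intro A hAΩ hgA hAne x hx
    by_cases hx0 : x = 0
    · subst hx0
      simpa using hx
    have hxK : x ∈ closure (coneSet f Ω) :=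
      closure_mono (fun v (hv : v ∈ coneSet f A) => (⟨hv.1, hv.2.1, hAΩ hv.2.2⟩ : v ∈ coneSet f Ω)) hx
    refine mem_closure_coneSet (smul_ne_zero hc (hg0 hx0)) (pos x hxK hx0) ?_
    rw [mkeq x hx0]
    exact pact_closure hgA.subset hx0 (hg0 hx0) (mk_mem_closure hx0 hx)
  · rintro x hx hxO ⟨h1, h2, h3⟩
    have hx0 : x ≠ 0 := by rintro rfl; simp at h2
    rw [mkeq x hx0, ← pact_mk g hx0, ← hgΩ] at h3
    obtain ⟨y, hy, he⟩ := h3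
    rw [pact_inj g he] at hy
    exact hxO ⟨hK.fpos x hx hx0, hx0, hy⟩

theorem fieldB (T : NCCTriple d) {M : ℝ}
    (hf : ∀ x ∈ closure T.Ω, chartOf T.Ω x.rep ≠ 0)
    (hK : ConeHyp (closure (coneSet (chartOf T.Ω) T.Ω)) (coneSet (chartOf T.Ω) T.Ω) (chartOf T.Ω) M)
    (p : ℕ → (Fin d → ℝ)) (v : Fin d → ℝ) (hpQ : ∀ n, p n ∈ closure (coneSet (chartOf T.Ω) T.C))
    (hpO : ∀ n, p n ∈ coneSet (chartOf T.Ω) T.Ω) (hpv : Tendsto p atTop (nhds v))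
    (hv0 : v ≠ 0) (hvK : v ∈ closure (coneSet (chartOf T.Ω) T.Ω))
    (hvO : v ∉ coneSet (chartOf T.Ω) T.Ω) :
    ∃ (G : ℕ → (Fin d → ℝ) →ₗ[ℝ] (Fin d → ℝ)) (ψ : ℕ → ℕ) (q : Fin d → ℝ), StrictMono ψ ∧
      (∀ n, ∀ x ∈ closure (coneSet (chartOf T.Ω) T.Ω), G n x ∈ closure (coneSet (chartOf T.Ω) T.Ω)) ∧
      (∀ n, ∀ x ∈ closure (coneSet (chartOf T.Ω) T.C), G n x ∈ closure (coneSet (chartOf T.Ω) T.C)) ∧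
      (∀ n, ∀ x ∈ closure (coneSet (chartOf T.Ω) T.Ω), x ∉ coneSet (chartOf T.Ω) T.Ω →
        G n x ∉ coneSet (chartOf T.Ω) T.Ω) ∧ q ∈ coneSet (chartOf T.Ω) T.Ω ∧
      Tendsto (fun n => G n (p (ψ n))) atTop (nhds q) ∧
      ∀ m ∈ coneSet (chartOf T.Ω) T.Ω, ∀ (r : ℕ → ℝ) (θ : Fin d → ℝ) (χ : ℕ → ℕ), StrictMono χ →
        Tendsto (fun n => r n • G (χ n) m) atTop (nhds θ) → θ ∉ coneSet (chartOf T.Ω) T.Ω := by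
  set f := chartOf T.Ω with hfd
  obtain ⟨Kc, hKcC, hKc, hcov⟩ := T.cocompact
  have hg0 : ∀ (g : (Fin d → ℝ) ≃ₗ[ℝ] (Fin d → ℝ)) {x}, x ≠ 0 → g x ≠ 0 := fun g x h => by
    simpa using h
  have hp0 : ∀ n, p n ≠ 0 := fun n => (hpO n).2.1
  have hex : ∀ n, ∃ g ∈ T.Λ, Projectivization.mk ℝ (g (p n)) (hg0 g (hp0 n)) ∈ Kc := by
    intro n
    have hC : Projectivization.mk ℝ (p n) (hp0 n) ∈ T.C :=
      T.C_closedInΩ ⟨mk_mem_closure (hp0 n) (hpQ n), (hpO n).2.2⟩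
    have := hcov hC
    simp only [mem_iUnion] at this
    obtain ⟨g', hg', k, hk, he⟩ := this
    refine ⟨g'⁻¹, T.Λ.inv_mem hg', ?_⟩
    have hk' : Projectivization.mk ℝ (g'⁻¹ (p n)) (hg0 g'⁻¹ (hp0 n)) = k := by
      apply pact_inj g'
      rw [he, pact_mk g' (hg0 g'⁻¹ (hp0 n)) (hg0 g' (hg0 g'⁻¹ (hp0 n)))]
      congr 1
      exact g'.apply_symm_apply (p n)
    rw [hk']; exact hk
  choose g hgΛ hgK using hex
  have hfK : ∀ q ∈ Kc, f q.rep ≠ 0 := fun q hq => hf q (subset_closure (T.C_sub (hKcC hq)))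
  have hcomp : IsCompact (chartMap f '' Kc) :=
    hKc.image_of_continuousOn fun q hq => (chartMap_continuousAt f (hfK q hq)).continuousWithinAt
  have hseq : ∀ n, (f (g n (p n)))⁻¹ • g n (p n) ∈ chartMap f '' Kc := fun n =>
    ⟨_, hgK n, chartMap_mk f _⟩
  obtain ⟨q, hq, ψ, hψ, hlim⟩ := hcomp.tendsto_subseq hseq
  have fne : ∀ n, f (g n (p n)) ≠ 0 := fun n => by
    have := hfK _ (hgK n)
    rwa [rep_ne_iff] at this
  have qO : q ∈ coneSet f T.Ω := by
    obtain ⟨k, hk, rfl⟩ := hq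
    obtain ⟨h0, h1, h2⟩ := exists_lift hf (subset_closure (T.C_sub (hKcC hk)))
    exact ⟨by rw [h1]; exact one_pos, h0, by rw [h2]; exact T.C_sub (hKcC hk)⟩
  have hpres := fun n => pres hf hK (T.inv_Ω _ (hgΛ n)) (c := (f (g n (p n)))⁻¹) (hpO n)
    (by rw [← hfd, map_smul, smul_eq_mul, inv_mul_cancel₀ (fne n)]; exact one_pos)
  refine ⟨fun n => (f (g (ψ n) (p (ψ n))))⁻¹ • (g (ψ n)).toLinearMap, ψ, q, hψ, ?_, ?_, ?_, qO,
    hlim, ?_⟩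
  · exact fun n x hx => (hpres (ψ n)).1 T.Ω subset_rfl (T.inv_Ω _ (hgΛ _)) T.nonempty_Ω x hx
  · exact fun n x hx => (hpres (ψ n)).1 T.C T.C_sub (T.inv_C _ (hgΛ _)) T.C_nonempty x hx
  · exact fun n x hx hxO => (hpres (ψ n)).2 x hx hxO
  intro m hm r θ χ hχ hθ hθO
  obtain ⟨ρ, hρ, hball⟩ := Metric.nhds_basis_closedBall.mem_iff.1 (hK.openO.mem_nhds hθO)
  have hX : IsCompact ({q : PSpace d | ∃ u ∈ Metric.closedBall θ ρ, ∃ h : u ≠ 0,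
      q = Projectivization.mk ℝ u h} ∪ {Projectivization.mk ℝ m hm.2.1}) :=
    (isCompact_mk (isCompact_closedBall θ ρ) fun h => hK.zeroO (hball h)).union isCompact_singleton
  have hfin := T.discrete_Λ _ (by
    rintro _ (⟨u, hu, h, rfl⟩ | rfl)
    · exact (hball hu).2.2
    · exact hm.2.2) hX
  have hev : ∀ᶠ n in atTop, g (ψ (χ n)) ∈ {g : (Fin d → ℝ) ≃ₗ[ℝ] (Fin d → ℝ) | g ∈ T.Λ ∧
      (pact g '' ({q : PSpace d | ∃ u ∈ Metric.closedBall θ ρ, ∃ h : u ≠ 0,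
      q = Projectivization.mk ℝ u h} ∪ {Projectivization.mk ℝ m hm.2.1}) ∩
      ({q : PSpace d | ∃ u ∈ Metric.closedBall θ ρ, ∃ h : u ≠ 0,
      q = Projectivization.mk ℝ u h} ∪ {Projectivization.mk ℝ m hm.2.1})).Nonempty} := by
    filter_upwards [hθ (Metric.closedBall_mem_nhds θ hρ)] with n hn
    refine ⟨hgΛ _, Projectivization.mk ℝ (g (ψ (χ n)) m) (hg0 _ hm.2.1), ⟨_, Or.inr rfl, rfl⟩,
      Or.inl ⟨_, hn, (hball hn).2.1, ?_⟩⟩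
    rw [eq_comm, Projectivization.mk_eq_mk_iff']
    refine ⟨r n * (f (g (ψ (χ n)) (p (ψ (χ n)))))⁻¹, ?_⟩
    rw [mul_smul]; rfl
  have hnot : ∀ᶠ n in atTop, ∀ g' ∈ {g : (Fin d → ℝ) ≃ₗ[ℝ] (Fin d → ℝ) | g ∈ T.Λ ∧
      (pact g '' ({q : PSpace d | ∃ u ∈ Metric.closedBall θ ρ, ∃ h : u ≠ 0,
      q = Projectivization.mk ℝ u h} ∪ {Projectivization.mk ℝ m hm.2.1}) ∩
      ({q : PSpace d | ∃ u ∈ Metric.closedBall θ ρ, ∃ h : u ≠ 0,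
      q = Projectivization.mk ℝ u h} ∪ {Projectivization.mk ℝ m hm.2.1})).Nonempty},
      g (ψ (χ n)) ≠ g' := by
    rw [eventually_all_finite hfin]
    rintro g' ⟨hg', -⟩
    by_contra hcon
    rw [Filter.not_eventually] at hcon
    have hclos := pact_closure (T.inv_Ω g' hg').subset hv0 (hg0 g' hv0) (mk_mem_closure hv0 hvK)
    have fgv : f (g' v) ≠ 0 := by
      have := hf _ hclos
      rwa [rep_ne_iff] at this
    have hgc : Continuous g' := LinearMap.continuous_of_finiteDimensional g'.toLinearMap
    have hpl : Tendsto (fun n => g' (p (ψ (χ n)))) atTop (nhds (g' v)) :=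
      (hgc.tendsto v).comp (hpv.comp (hψ.comp hχ).tendsto_atTop)
    have hl2 : Tendsto (fun n => (f (g' (p (ψ (χ n)))))⁻¹ • g' (p (ψ (χ n)))) atTop
        (nhds ((f (g' v))⁻¹ • g' v)) :=
      ((((lin_cont f).tendsto _).comp hpl).inv₀ fgv).smul hpl
    have hl3 := (hlim.comp hχ.tendsto_atTop).sub hl2
    have hmem := (isClosed_singleton (x := (0 : Fin d → ℝ))).mem_of_frequently_of_tendsto
      (hcon.mono fun n hn => by
        have hn' : g (ψ (χ n)) = g' := not_not.1 hn
        simp only [Function.comp_apply, hn', sub_self, mem_singleton_iff]) hl3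
    have heq : q = (f (g' v))⁻¹ • g' v := sub_eq_zero.1 hmem
    obtain ⟨-, h2, h3⟩ := heq ▸ qO
    rw [mk_smul (hg0 g' hv0) (inv_ne_zero fgv), ← pact_mk g' hv0, ← T.inv_Ω g' hg'] at h3
    obtain ⟨y, hy, he⟩ := h3
    rw [pact_inj g' he] at hy
    exact hvO ⟨hK.fpos v hvK hv0, hv0, hy⟩
  obtain ⟨n, h1, h2⟩ := (hev.and hnot).exists
  exact h2 _ h1 rfl

theorem mk_closure_of_tendsto {A : Set (PSpace d)} {w : ℕ → (Fin d → ℝ)} {v : Fin d → ℝ}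
    (hv : v ≠ 0) (hw : Tendsto w atTop (nhds v))
    (hA : ∀ n, ∃ h : w n ≠ 0, Projectivization.mk ℝ (w n) h ∈ A) :
    Projectivization.mk ℝ v hv ∈ closure A := by
  rw [mem_closure_iff]
  intro U hU hvU
  obtain ⟨n, h0, hn⟩ := (hw.eventually ((isOpen_lift hU).mem_nhds ⟨hv, hvU⟩)).exists
  obtain ⟨h1, h2⟩ := hA n
  exact ⟨_, hn, h2⟩

/-- extension by zero of a vector with three coordinates -/
def ext3 (hp : 3 ≤ d) : (Fin 3 → ℝ) →ₗ[ℝ] (Fin d → ℝ) where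
  toFun a i := if h : (i : ℕ) < 3 then a ⟨i, h⟩ else 0
  map_add' a b := by ext i; by_cases h : (i : ℕ) < 3 <;> simp [h]
  map_smul' c a := by ext i; by_cases h : (i : ℕ) < 3 <;> simp [h]

theorem ext3_castLE (hp : 3 ≤ d) (a : Fin 3 → ℝ) (j : Fin 3) : ext3 hp a (Fin.castLE hp j) = a j := by
  simp [ext3]

theorem ext3_inj (hp : 3 ≤ d) : Function.Injective (ext3 hp) := by
  intro a b hab
  ext j
  rw [← ext3_castLE hp a, hab, ext3_castLE]

theorem ext3_single (hp : 3 ≤ d) (j : Fin 3) :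
    ext3 hp (Pi.single j 1) = Pi.single (Fin.castLE hp j) 1 := by
  ext i
  by_cases h : (i : ℕ) < 3
  · by_cases hij : i = Fin.castLE hp j
    · subst hij; simp [ext3]
    · have : (⟨i, h⟩ : Fin 3) ≠ j := by
        rintro rfl; exact hij (by ext; simp)
      simp [ext3, h, hij, this]
  · have hij : i ≠ Fin.castLE hp j := by
      rintro rfl; exact h (by simp)
    simp [ext3, h, hij]

theorem mem_simplexCone_iff (hp : 3 ≤ d) (v : Fin d → ℝ) :
    v ∈ simplexCone (d := d) 3 ↔ ∃ a : Fin 3 → ℝ, (∀ j, 0 < a j) ∧ v = ext3 hp a := by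
  constructor
  · rintro ⟨h1, h2⟩
    refine ⟨fun j => v (Fin.castLE hp j), fun j => h1 _ (by simp), ?_⟩
    ext i
    by_cases h : (i : ℕ) < 3
    · simp only [ext3, LinearMap.coe_mk, AddHom.coe_mk, h, dif_pos]
      congr 1
    · simp [ext3, h, h2 i (not_lt.1 h)]
  · rintro ⟨a, ha, rfl⟩
    refine ⟨fun i hi => ?_, fun i hi => ?_⟩
    · simp only [ext3, LinearMap.coe_mk, AddHom.coe_mk, hi, dif_pos]
      exact ha _
    · simp [ext3, not_lt.2 hi]

theorem eqv_comb {K O : Set (Fin d → ℝ)} {f : (Fin d → ℝ) →ₗ[ℝ] ℝ} {M : ℝ} (h : ConeHyp K O f M)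
    {x y : Fin d → ℝ} (hx : x ∈ K) (hy : y ∈ K) {a b : ℝ} (ha : 0 < a) (hb : 0 < b) :
    Eqv K (a • x + b • y) (x + y) := by
  have ax := h.smul a ha.le x hx
  have bY := h.smul b hb.le y hy
  exact ⟨Le.add_le h (Le.smul_left h ha (le_add_self h hx hy)) (Le.smul_left h hb (le_self_add h hx hy)),
    Le.add_le h (Le.add_right h (Le.smul_right h ha (Le.refl' h hx)) bY)
      (Le.add_left h (Le.smul_right h hb (Le.refl' h hy)) ax)⟩

theorem simplex_data {Ω C S : Set (PSpace d)} {M : ℝ}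
    (hf : ∀ x ∈ closure Ω, chartOf Ω x.rep ≠ 0)
    (hK : ConeHyp (closure (coneSet (chartOf Ω) Ω)) (coneSet (chartOf Ω) Ω) (chartOf Ω) M)
    (hCΩ : C ⊆ Ω) (hCcl : closure C ∩ Ω ⊆ C) (hp : 3 ≤ d)
    {g : (Fin d → ℝ) ≃ₗ[ℝ] (Fin d → ℝ)} (hS : IsSimplexWithMap 3 S g)
    (hpe : IsProperlyEmbedded S C) :
    ∃ σ : ℝ, σ ≠ 0 ∧ ∃ u : Fin 3 → (Fin d → ℝ),
      (∀ j, u j = σ • g (Pi.single (Fin.castLE hp j) 1)) ∧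
      Tri (closure (coneSet (chartOf Ω) Ω)) (coneSet (chartOf Ω) Ω)
        (closure (coneSet (chartOf Ω) C)) (u 0) (u 1) (u 2) ∧
      ∀ z ∈ closure S \ S, ∃ y ∈ closure (coneSet (chartOf Ω) Ω), ∃ h : y ≠ 0,
        z = Projectivization.mk ℝ y h ∧
        ((∃ i, Eqv (closure (coneSet (chartOf Ω) Ω)) y (u i)) ∨
          ∃ i j, i ≠ j ∧ Eqv (closure (coneSet (chartOf Ω) Ω)) y (u i + u j)) := by
  set f := chartOf Ω with hfd
  obtain ⟨hSC, hprop⟩ := hpe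
  have hScl : closure S ∩ C ⊆ S := by
    have h1 := hprop.isClosedMap.isClosed_range
    obtain ⟨t, ht, hts⟩ := Topology.IsInducing.subtypeVal.isClosed_iff.1 h1
    rintro x ⟨hx, hxC⟩
    have hSt : S ⊆ t := by
      intro s hs
      have : (⟨s, hSC hs⟩ : C) ∈ Subtype.val ⁻¹' t := by
        rw [hts]; exact ⟨⟨s, hs⟩, rfl⟩
      exact this
    have hxt : (⟨x, hxC⟩ : C) ∈ Subtype.val ⁻¹' t := closure_minimal hSt ht hx
    rw [hts] at hxt
    obtain ⟨⟨s, hs⟩, he⟩ := hxt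
    have := congrArg Subtype.val he
    simp only [Set.inclusion] at this
    exact this ▸ hs
  set A : (Fin 3 → ℝ) →ₗ[ℝ] (Fin d → ℝ) := g.toLinearMap ∘ₗ ext3 hp with hA
  have Ainj : Function.Injective A := g.injective.comp (ext3_inj hp)
  have A0 : ∀ {a}, a ≠ 0 → A a ≠ 0 := fun h h' => h (Ainj (by rw [h', map_zero]))
  have hpos0 : ∀ {a : Fin 3 → ℝ}, (∀ j, 0 < a j) → a ≠ 0 := fun h h' => by
    have := h 0; rw [h'] at this; simp at this
  have hSmem : ∀ q, q ∈ S ↔ ∃ a : Fin 3 → ℝ, (∀ j, 0 < a j) ∧ ∃ h : A a ≠ 0,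
      q = Projectivization.mk ℝ (A a) h := by
    intro q
    rw [hS]
    constructor
    · rintro ⟨v, hv, hv0, rfl⟩
      obtain ⟨a, ha, rfl⟩ := (mem_simplexCone_iff hp v).1 hv
      exact ⟨a, ha, A0 (hpos0 ha), rfl⟩
    · rintro ⟨a, ha, h, rfl⟩
      refine ⟨ext3 hp a, (mem_simplexCone_iff hp _).2 ⟨a, ha, rfl⟩, ?_, rfl⟩
      intro h'
      exact h (by simp [hA, h'])
  have Acont : Continuous A := LinearMap.continuous_of_finiteDimensional A
  have hcl : ∀ (a : Fin 3 → ℝ), (∀ j, 0 ≤ a j) → ∀ h : A a ≠ 0,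
      Projectivization.mk ℝ (A a) h ∈ closure S := by
    intro a ha h
    have ht0 : Tendsto (fun n : ℕ => A (a + (1 / ((n : ℝ) + 1)) • (fun _ => 1))) atTop (nhds (A a)) := by
      have h1 : Tendsto (fun n : ℕ => a + (1 / ((n : ℝ) + 1)) • (fun _ : Fin 3 => (1 : ℝ))) atTop
          (nhds a) := by
        have := (tendsto_one_div_add_atTop_nhds_zero_nat (𝕜 := ℝ)).smul_const (fun _ : Fin 3 => (1 : ℝ))
        have := this.const_add a
        rwa [zero_smul, add_zero] at this
      exact (Acont.tendsto a).comp h1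
    refine mk_closure_of_tendsto h ht0 fun n => ?_
    have hpos : ∀ j, 0 < (a + (1 / ((n : ℝ) + 1)) • (fun _ : Fin 3 => (1 : ℝ))) j := fun j => by
      simp only [Pi.add_apply, Pi.smul_apply, smul_eq_mul, mul_one]
      have := ha j
      positivity
    exact ⟨A0 (hpos0 hpos), (hSmem _).2 ⟨_, hpos, A0 (hpos0 hpos), rfl⟩⟩
  have fne : ∀ (a : Fin 3 → ℝ), (∀ j, 0 ≤ a j) → a ≠ 0 → f (A a) ≠ 0 := by
    intro a ha h
    rw [← rep_ne_iff f (A0 h)]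
    exact hf _ (closure_mono (hSC.trans hCΩ) (hcl a ha (A0 h)))
  set E : Fin 3 → (Fin d → ℝ) := fun j => g (Pi.single (Fin.castLE hp j) 1) with hE
  have AE : ∀ a : Fin 3 → ℝ, A a = a 0 • E 0 + a 1 • E 1 + a 2 • E 2 := by
    intro a
    have e : a = a 0 • Pi.single 0 1 + a 1 • Pi.single 1 1 + a 2 • Pi.single 2 1 := by
      ext j; fin_cases j <;> simp
    conv_lhs => rw [e]
    simp only [map_add, map_smul, hE]
    simp only [← ext3_single]
    rfl
  have vne : ∀ {x y z : ℝ}, x ≠ 0 ∨ y ≠ 0 ∨ z ≠ 0 → (![x, y, z] : Fin 3 → ℝ) ≠ 0 := by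
    intro x y z h h'
    have h0 := congrFun h' 0
    have h1 := congrFun h' 1
    have h2 := congrFun h' 2
    simp at h0 h1 h2
    tauto
  have v0 : ∀ {x y z : ℝ}, 0 ≤ x → 0 ≤ y → 0 ≤ z → ∀ j, 0 ≤ (![x, y, z] : Fin 3 → ℝ) j := by
    intro x y z h0 h1 h2 j
    fin_cases j <;> simpa
  have f0 : f (E 0) ≠ 0 := by
    have := fne ![1, 0, 0] (v0 zero_le_one le_rfl le_rfl) (vne (Or.inl one_ne_zero))
    rw [AE] at this; simpa using this
  set σ := f (E 0) with hσ
  have hs1 : 0 < σ * f (E 1) := by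
    by_contra hn
    have hn := not_lt.1 hn
    have := fne ![-(σ * f (E 1)), σ * σ, 0] (v0 (by linarith) (mul_self_nonneg σ) le_rfl)
      (vne (Or.inr (Or.inl (mul_ne_zero f0 f0))))
    rw [AE] at this
    apply this
    simp only [Matrix.cons_val, map_add, map_smul, smul_eq_mul, ← hσ]
    ring
  have hs2 : 0 < σ * f (E 2) := by
    by_contra hn
    have hn := not_lt.1 hn
    have := fne ![-(σ * f (E 2)), 0, σ * σ] (v0 (by linarith) le_rfl (mul_self_nonneg σ))
      (vne (Or.inr (Or.inr (mul_ne_zero f0 f0))))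
    rw [AE] at this
    apply this
    simp only [Matrix.cons_val, map_add, map_smul, smul_eq_mul, ← hσ]
    ring
  have hs0 : 0 < σ * σ := mul_self_pos.2 f0
  have fpos : ∀ (a : Fin 3 → ℝ), (∀ j, 0 ≤ a j) → a ≠ 0 → 0 < f (σ • A a) := by
    intro a ha h
    refine lt_of_le_of_ne ?_ (Ne.symm ?_)
    · rw [AE]
      simp only [map_add, map_smul, smul_eq_mul, ← hσ]
      have := mul_nonneg (ha 0) hs0.le
      have := mul_nonneg (ha 1) hs1.le
      have := mul_nonneg (ha 2) hs2.le
      linarith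
    · rw [map_smul, smul_eq_mul]; exact mul_ne_zero f0 (fne a ha h)
  have memQ : ∀ (a : Fin 3 → ℝ), (∀ j, 0 ≤ a j) → a ≠ 0 → σ • A a ∈ closure (coneSet f C) := by
    intro a ha h
    refine mem_closure_coneSet (smul_ne_zero f0 (A0 h)) (fpos a ha h) ?_
    rw [mk_smul (A0 h) f0]
    exact closure_mono hSC (hcl a ha _)
  have notO : ∀ (a : Fin 3 → ℝ), (∀ j, 0 ≤ a j) → a ≠ 0 → (∃ j, a j = 0) →
      σ • A a ∉ coneSet f Ω := by
    rintro a ha h ⟨j, hj⟩ ⟨-, h1, h2⟩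
    rw [mk_smul (A0 h) f0] at h2
    have h3 := hScl ⟨hcl a ha (A0 h), hCcl ⟨closure_mono hSC (hcl a ha _), h2⟩⟩
    obtain ⟨b, hb, hb0, he⟩ := (hSmem _).1 h3
    rw [Projectivization.mk_eq_mk_iff'] at he
    obtain ⟨c, hc⟩ := he
    rw [← map_smul] at hc
    have hc' := Ainj hc
    have := congrFun hc' j
    rw [hj, Pi.smul_apply, smul_eq_mul] at this
    have hc0 : c = 0 := (mul_eq_zero.1 this).resolve_right (hb j).ne'
    rw [hc0, zero_smul] at hc'
    exact h hc'.symm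
  have hQK : closure (coneSet f C) ⊆ closure (coneSet f Ω) :=
    closure_mono fun v (hv : v ∈ coneSet f C) => (⟨hv.1, hv.2.1, hCΩ hv.2.2⟩ : v ∈ coneSet f Ω)
  have uQ : ∀ j, σ • E j ∈ closure (coneSet f C) := by
    intro j
    have h1 := memQ ![1, 0, 0] (v0 zero_le_one le_rfl le_rfl) (vne (Or.inl one_ne_zero))
    have h2 := memQ ![0, 1, 0] (v0 le_rfl zero_le_one le_rfl) (vne (Or.inr (Or.inl one_ne_zero)))
    have h3 := memQ ![0, 0, 1] (v0 le_rfl le_rfl zero_le_one) (vne (Or.inr (Or.inr one_ne_zero)))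
    rw [AE] at h1 h2 h3
    fin_cases j
    · simpa using h1
    · simpa using h2
    · simpa using h3
  refine ⟨σ, f0, fun j => σ • E j, fun j => rfl, ⟨uQ 0, uQ 1, uQ 2, ?_, ?_, ?_, ?_⟩, ?_⟩
  · have hpos : ∀ j : Fin 3, 0 < (![1, 1, 1] : Fin 3 → ℝ) j := by intro j; fin_cases j <;> simp
    have h1 := fpos ![1, 1, 1] (fun j => (hpos j).le) (hpos0 hpos)
    have h2 : σ • A ![1, 1, 1] ∈ coneSet f Ω := by
      refine ⟨h1, smul_ne_zero f0 (A0 (hpos0 hpos)), ?_⟩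
      rw [mk_smul (A0 (hpos0 hpos)) f0]
      exact hCΩ (hSC ((hSmem _).2 ⟨_, hpos, _, rfl⟩))
    rw [AE] at h2
    simpa using h2
  · have := notO ![1, 1, 0] (v0 zero_le_one zero_le_one le_rfl) (vne (Or.inl one_ne_zero)) ⟨2, by simp⟩
    rw [AE] at this; simpa using this
  · have := notO ![1, 0, 1] (v0 zero_le_one le_rfl zero_le_one) (vne (Or.inl one_ne_zero)) ⟨1, by simp⟩
    rw [AE] at this; simpa using this
  · have := notO ![0, 1, 1] (v0 le_rfl zero_le_one zero_le_one)
      (vne (Or.inr (Or.inl one_ne_zero))) ⟨0, by simp⟩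
    rw [AE] at this; simpa using this
  rintro z ⟨hz, hzS⟩
  have hzΩ : z ∈ closure Ω := closure_mono (hSC.trans hCΩ) hz
  obtain ⟨h0, h1, h2⟩ := exists_lift hf hzΩ
  have hyS : chartMap f z ∈ closure (coneSet f S) :=
    mem_closure_coneSet h0 (by rw [h1]; exact one_pos) (by rw [h2]; exact hz)
  set y := chartMap f z with hy
  have hPcl : IsClosed ((fun a => (σ • A) a) '' {a : Fin 3 → ℝ | ∀ j, 0 ≤ a j}) := by
    have hinj : Function.Injective (σ • A) := by
      intro a b hab
      simp only [LinearMap.smul_apply] at hab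
      exact Ainj (smul_right_injective _ f0 hab)
    have hemb := LinearMap.isClosedEmbedding_of_injective (LinearMap.ker_eq_bot.2 hinj)
    refine hemb.isClosedMap _ ?_
    simp only [Set.ofPred_forall]
    exact isClosed_iInter fun j => isClosed_le continuous_const (continuous_apply j)
  have hsub : coneSet f S ⊆ (fun a => (σ • A) a) '' {a : Fin 3 → ℝ | ∀ j, 0 ≤ a j} := by
    rintro v ⟨hv1, hv0, hvS⟩
    obtain ⟨a, ha, ha0, he⟩ := (hSmem _).1 hvS
    rw [Projectivization.mk_eq_mk_iff'] at he
    obtain ⟨c, rfl⟩ := he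
    have hpa := fpos a (fun j => (ha j).le) (hpos0 ha)
    have hc : 0 < c / σ := by
      have e : f (c • A a) = (c / σ) * f (σ • A a) := by
        simp only [map_smul, smul_eq_mul]; field_simp
      rw [e] at hv1
      exact pos_of_mul_pos_left hv1 hpa.le
    refine ⟨(c / σ) • a, fun j => by simpa using mul_nonneg hc.le (ha j).le, ?_⟩
    simp only [LinearMap.smul_apply, map_smul, smul_smul]
    congr 1
    field_simp
  obtain ⟨a, ha, hay⟩ := closure_minimal hsub hPcl hyS
  simp only [LinearMap.smul_apply] at hay
  refine ⟨y, closure_mono (fun v (hv : v ∈ coneSet f S) => (⟨hv.1, hv.2.1, hCΩ (hSC hv.2.2)⟩ :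
    v ∈ coneSet f Ω)) hyS, h0, h2.symm, ?_⟩
  have hye : y = a 0 • σ • E 0 + a 1 • σ • E 1 + a 2 • σ • E 2 := by
    rw [← hay, AE]; module
  have uK := fun j => hQK (uQ j)
  have key : ¬ (0 < a 0 ∧ 0 < a 1 ∧ 0 < a 2) := by
    rintro ⟨p0, p1, p2⟩
    have hpos : ∀ j, 0 < a j := by intro j; fin_cases j <;> assumption
    apply hzS
    rw [hSmem]
    refine ⟨a, hpos, A0 (hpos0 hpos), ?_⟩
    rw [← h2, Projectivization.mk_eq_mk_iff']
    exact ⟨σ, hay⟩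
  rcases (ha 0).eq_or_lt with p0 | p0 <;> rcases (ha 1).eq_or_lt with p1 | p1 <;>
    rcases (ha 2).eq_or_lt with p2 | p2
  · exact absurd (by rw [hye, ← p0, ← p1, ← p2]; simp) h0
  · left; refine ⟨2, ?_⟩
    rw [hye, ← p0, ← p1, zero_smul, zero_smul, zero_add, zero_add]
    exact Eqv.smul' hK p2 (uK 2)
  · left; refine ⟨1, ?_⟩
    rw [hye, ← p0, ← p2, zero_smul, zero_smul, zero_add, add_zero]
    exact Eqv.smul' hK p1 (uK 1)
  · right; refine ⟨1, 2, by decide, ?_⟩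
    rw [hye, ← p0, zero_smul, zero_add]
    exact eqv_comb hK (uK 1) (uK 2) p1 p2
  · left; refine ⟨0, ?_⟩
    rw [hye, ← p1, ← p2, zero_smul, zero_smul, add_zero, add_zero]
    exact Eqv.smul' hK p0 (uK 0)
  · right; refine ⟨0, 2, by decide, ?_⟩
    rw [hye, ← p1, zero_smul, add_zero]
    exact eqv_comb hK (uK 0) (uK 2) p0 p2
  · right; refine ⟨0, 1, by decide, ?_⟩
    rw [hye, ← p2, zero_smul, add_zero]
    exact eqv_comb hK (uK 0) (uK 1) p0 p1
  · exact absurd ⟨p0, p1, p2⟩ key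

theorem simplex_perm {S : Set (PSpace d)} (hp : 3 ≤ d) {g : (Fin d → ℝ) ≃ₗ[ℝ] (Fin d → ℝ)}
    (hS : IsSimplexWithMap 3 S g) (τ : Equiv.Perm (Fin 3)) :
    ∃ g' : (Fin d → ℝ) ≃ₗ[ℝ] (Fin d → ℝ), IsSimplexWithMap 3 S g' ∧
      ∀ j, g' (Pi.single (Fin.castLE hp j) 1) = g (Pi.single (Fin.castLE hp (τ j)) 1) := by
  let e : Equiv.Perm (Fin d) := τ.viaFintypeEmbedding (Fin.castLEEmb hp)
  have he : ∀ j, e (Fin.castLE hp j) = Fin.castLE hp (τ j) := fun j =>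
    Equiv.Perm.viaFintypeEmbedding_apply_image τ (Fin.castLEEmb hp) j
  let L : (Fin d → ℝ) ≃ₗ[ℝ] (Fin d → ℝ) := LinearEquiv.funCongrLeft ℝ ℝ e.symm
  have hL : ∀ v i, L v i = v (e.symm i) := fun v i => rfl
  have hL3 : ∀ a : Fin 3 → ℝ, L (ext3 hp a) = ext3 hp (a ∘ τ.symm) := by
    intro a
    ext i
    rw [hL]
    by_cases h : (i : ℕ) < 3
    · obtain ⟨j, rfl⟩ : ∃ j, i = Fin.castLE hp (τ j) := ⟨τ.symm ⟨i, h⟩, by ext; simp⟩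
      rw [← he, Equiv.symm_apply_apply, he, ext3_castLE, ext3_castLE]
      simp
    · have h2 : e.symm i = i := by
        rw [Equiv.symm_apply_eq]
        symm
        apply Equiv.Perm.viaFintypeEmbedding_apply_notMem_range
        rintro ⟨j, rfl⟩
        exact h (by simp)
      rw [h2]
      simp [ext3, h]
  have hcone : ∀ v, L v ∈ simplexCone (d := d) 3 ↔ v ∈ simplexCone (d := d) 3 := by
    intro v
    simp only [mem_simplexCone_iff hp]
    constructor
    · rintro ⟨a, ha, h⟩
      refine ⟨a ∘ τ, fun j => ha _, L.injective ?_⟩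
      rw [hL3, h]
      congr 1
      ext j; simp
    · rintro ⟨a, ha, rfl⟩
      exact ⟨a ∘ τ.symm, fun j => ha _, hL3 a⟩
  refine ⟨L.trans g, ?_, fun j => ?_⟩
  · unfold IsSimplexWithMap at hS ⊢
    rw [hS]
    ext q
    constructor
    · rintro ⟨v, hv, hv0, rfl⟩
      refine ⟨L.symm v, ?_, by simpa using hv0, ?_⟩
      · rw [← hcone]; simpa using hv
      · congr 1; simp
    · rintro ⟨v, hv, hv0, rfl⟩
      exact ⟨L v, (hcone v).2 hv, by simpa using hv0, rfl⟩
  · rw [LinearEquiv.trans_apply, ← ext3_single, hL3, ← ext3_single]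
    congr 2
    ext i
    by_cases h : i = τ j
    · subst h; simp
    · have : τ.symm i ≠ j := by
        rintro rfl; simp at h
      simp [h, this]

theorem face_eq_of_eqv {Ω : Set (PSpace d)} {M : ℝ}
    (hf : ∀ x ∈ closure Ω, chartOf Ω x.rep ≠ 0)
    (hK : ConeHyp (closure (coneSet (chartOf Ω) Ω)) (coneSet (chartOf Ω) Ω) (chartOf Ω) M)
    {x y : Fin d → ℝ} (hx0 : x ≠ 0) (hy0 : y ≠ 0)
    (hx : x ∈ closure (coneSet (chartOf Ω) Ω)) (hy : y ∈ closure (coneSet (chartOf Ω) Ω))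
    (he : Eqv (closure (coneSet (chartOf Ω) Ω)) x y) :
    face Ω (Projectivization.mk ℝ x hx0) = face Ω (Projectivization.mk ℝ y hy0) := by
  have aux : ∀ {x y : Fin d → ℝ} (hx0 : x ≠ 0) (hy0 : y ≠ 0),
      x ∈ closure (coneSet (chartOf Ω) Ω) → y ∈ closure (coneSet (chartOf Ω) Ω) →
      Eqv (closure (coneSet (chartOf Ω) Ω)) x y →
      face Ω (Projectivization.mk ℝ x hx0) ⊆ face Ω (Projectivization.mk ℝ y hy0) := by
    intro x y hx0 hy0 hx hy he q hq
    obtain ⟨z, hz, hz0, rfl⟩ := exists_lift' hf hK (face_sub hf hK (mk_mem_closure hx0 hx) hq)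
    have h1 := eqv_of_mem_face hf hK hx0 hz0 hx hz hq
    exact mem_face_of_eqv hf hK hy0 hz0 hy hz (Eqv.trans' hK ⟨he.2, he.1⟩ h1)
  exact (aux hx0 hy0 hx hy he).antisymm (aux hy0 hx0 hy hx ⟨he.2, he.1⟩)

/-- Lemma 7.5: if all faces of the ideal boundary of a naive convex
co-compact triple have coarse dimension at most one, two properly embedded two-dimensional
simplices in `C` whose boundary face unions intersect are parallel. -/
theorem meeting_face_unions_implies_parallel {d : ℕ} (T : NCCTriple d)
    (hcdim : ∀ x ∈ idealBdry T.C, cdim (face T.Ω x) (idealBdry T.C ∩ face T.Ω x) ≤ 1)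
    (S₁ S₂ : Set (PSpace d))
    (hS₁ : IsSimplexOfDim 2 S₁) (hS₁sub : S₁ ⊆ T.C) (hS₁pe : IsProperlyEmbedded S₁ T.C)
    (hS₂ : IsSimplexOfDim 2 S₂) (hS₂sub : S₂ ⊆ T.C) (hS₂pe : IsProperlyEmbedded S₂ T.C)
    (hmeet : ((⋃ x ∈ closure S₁ \ S₁, face T.Ω x) ∩
        ⋃ x ∈ closure S₂ \ S₂, face T.Ω x).Nonempty) :
    ∃ v w : Fin 3 → PSpace d, HasVertices S₁ v ∧ HasVertices S₂ w ∧
      ∀ j : Fin 3, face T.Ω (v j) = face T.Ω (w j) := by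
  obtain ⟨hf, hcv, hbd⟩ := chartOf_spec T.properlyConvex_Ω
  obtain ⟨M, hM⟩ := isBounded_iff_forall_norm_le.1 hbd
  have hK : ConeHyp (closure (coneSet (chartOf T.Ω) T.Ω)) (coneSet (chartOf T.Ω) T.Ω)
      (chartOf T.Ω) (max M 0) :=
    coneHyp T.isOpen_Ω T.nonempty_Ω hf hcv (le_max_right _ _)
      fun x hx => (hM x hx).trans (le_max_left _ _)
  have hQK : closure (coneSet (chartOf T.Ω) T.C) ⊆ closure (coneSet (chartOf T.Ω) T.Ω) :=
    closure_mono fun v (hv : v ∈ coneSet (chartOf T.Ω) T.C) =>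
      (⟨hv.1, hv.2.1, T.C_sub hv.2.2⟩ : v ∈ coneSet (chartOf T.Ω) T.Ω)
  have hQne : (coneSet (chartOf T.Ω) T.C).Nonempty :=
    coneSet_nonempty T.C_nonempty fun x hx => hf x (subset_closure (T.C_sub hx))
  have hF : FullHyp (closure (coneSet (chartOf T.Ω) T.Ω)) (coneSet (chartOf T.Ω) T.Ω)
      (closure (coneSet (chartOf T.Ω) T.C)) (chartOf T.Ω) (max M 0) :=
    { toConeHyp := hK
      Qsub := hQK
      Qadd := fun x hx y hy => closure_add T.C_convex hx hy
      Qsmul := fun c hc x hx => closure_smul hQne hc hx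
      Qclosed := isClosed_closure
      H := fun x hx hx0 hxO => fieldH hf hK T.C_sub T.C_nonempty T.C_convex hcdim x hx hx0 hxO
      B := fun p v h1 h2 h3 h4 h5 h6 => fieldB T hf hK p v h1 h2 h3 h4 h5 h6 }
  obtain ⟨hp, g₁, hg₁⟩ := hS₁
  obtain ⟨-, g₂, hg₂⟩ := hS₂
  obtain ⟨σ₁, hσ₁, u, hu, t₁, hb₁⟩ := simplex_data hf hK T.C_sub T.C_closedInΩ hp hg₁ hS₁pe
  obtain ⟨σ₂, hσ₂, w, hw, t₂, hb₂⟩ := simplex_data hf hK T.C_sub T.C_closedInΩ hp hg₂ hS₂pe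
  obtain ⟨q, hq1, hq2⟩ := hmeet
  simp only [mem_iUnion] at hq1 hq2
  obtain ⟨z₁, hz₁, hqz₁⟩ := hq1
  obtain ⟨z₂, hz₂, hqz₂⟩ := hq2
  obtain ⟨x, hx, hx0, rfl, hxu⟩ := hb₁ z₁ hz₁
  obtain ⟨y, hy, hy0, rfl, hyw⟩ := hb₂ z₂ hz₂
  obtain ⟨z, hz, hz0, rfl⟩ := exists_lift' hf hK (face_sub hf hK (mk_mem_closure hx0 hx) hqz₁)
  have e1 := eqv_of_mem_face hf hK hx0 hz0 hx hz hqz₁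
  have e2 := eqv_of_mem_face hf hK hy0 hz0 hy hz hqz₂
  have hxy := Eqv.trans' hK e1 ⟨e2.2, e2.1⟩
  obtain ⟨τ, hτ⟩ := Core.main hF t₁ t₂ hxy hxu hyw
  obtain ⟨g₃, hg₃, hg₃τ⟩ := simplex_perm hp hg₂ τ
  have sne : ∀ j : Fin 3, (Pi.single (Fin.castLE hp j) 1 : Fin d → ℝ) ≠ 0 := fun j => by simp
  have gne : ∀ (g : (Fin d → ℝ) ≃ₗ[ℝ] (Fin d → ℝ)) (j : Fin 3),
      g (Pi.single (Fin.castLE hp j) 1) ≠ 0 := fun g j => by simpa using sne j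
  refine ⟨fun j => Projectivization.mk ℝ (g₁ (Pi.single (Fin.castLE hp j) 1)) (gne g₁ j),
    fun j => Projectivization.mk ℝ (g₃ (Pi.single (Fin.castLE hp j) 1)) (gne g₃ j),
    ⟨hp, g₁, hg₁, fun j => rfl⟩, ⟨hp, g₃, hg₃, fun j => rfl⟩, fun j => ?_⟩
  have uK : ∀ j, u j ∈ closure (coneSet (chartOf T.Ω) T.Ω) := fun j => by
    fin_cases j
    exacts [hQK t₁.ha, hQK t₁.hb, hQK t₁.hc]
  have wK : ∀ j, w j ∈ closure (coneSet (chartOf T.Ω) T.Ω) := fun j => by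
    fin_cases j
    exacts [hQK t₂.ha, hQK t₂.hb, hQK t₂.hc]
  have u0 : ∀ j, u j ≠ 0 := fun j => by rw [hu]; exact smul_ne_zero hσ₁ (gne g₁ j)
  have w0 : ∀ j, w j ≠ 0 := fun j => by rw [hw]; exact smul_ne_zero hσ₂ (gne g₂ j)
  have h1 := face_eq_of_eqv hf hK (u0 j) (w0 (τ j)) (uK j) (wK (τ j)) (hτ j)
  have h2 : Projectivization.mk ℝ (u j) (u0 j) =
      Projectivization.mk ℝ (g₁ (Pi.single (Fin.castLE hp j) 1)) (gne g₁ j) := by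
    rw [Projectivization.mk_eq_mk_iff']; exact ⟨σ₁, (hu j).symm⟩
  have h3 : Projectivization.mk ℝ (w (τ j)) (w0 (τ j)) =
      Projectivization.mk ℝ (g₃ (Pi.single (Fin.castLE hp j) 1)) (gne g₃ j) := by
    rw [Projectivization.mk_eq_mk_iff']
    exact ⟨σ₂, by rw [hg₃τ]; exact (hw (τ j)).symm⟩
  rw [h2, h3] at h1
  exact h1

end Paper
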